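/- Let U : ℤ → [0,∞) be a bounded nonnegative potential and let L_U = L + M_U, where M_U is multiplication by U, with semigroup P_t^U = exp(−tL_U). For every q ∈ (1,2] there exists a constant c_q > 0, depending only on q and s, such that for every summable f : ℤ → ℝ one has ‖G̃_U(f)‖_q ≤ c_q ‖f‖_q, where G̃_U(f)(x) = (∫₀^∞ (|∇̃(P_t^U f)|²(x) + U(x)·(P_t^U f(x))²) dt)^{1/2}. -/

import Mathlib

open MeasureTheory Real

/-- The kernel `K_s` of the fractional discrete Laplacian on `ℤ`. -/
noncomputable def Ker (s : ℝ) (m : ℤ) : ℝ :=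
  if m = 0 then 0
  else ((4 : ℝ) ^ s * Real.Gamma (1 / 2 + s) / (Real.sqrt Real.pi * |Real.Gamma (-s)|)) *
    (Real.Gamma ((m.natAbs : ℝ) - s) / Real.Gamma ((m.natAbs : ℝ) + 1 + s))

/-- The fractional discrete Laplacian `L = (-Δ)^s` acting pointwise. -/
noncomputable def Lop (s : ℝ) (f : ℤ → ℝ) : ℤ → ℝ :=
  fun x => ∑' y : ℤ, (f x - f y) * Ker s (x - y)

/-- The heat semigroup `P_t = exp (-t L)`, given by the exponential series of the
bounded operator `-tL` (evaluated pointwise). -/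
noncomputable def heat (s t : ℝ) (f : ℤ → ℝ) : ℤ → ℝ :=
  fun x => ∑' n : ℕ, ((-t) ^ n / (n.factorial : ℝ)) * ((Lop s)^[n] f x)

/-- The squared modulus of the gradient, `|∇f|²(x) = Σ_y K_s(y-x) (f x - f y)²`. -/
noncomputable def gradSq (s : ℝ) (f : ℤ → ℝ) (x : ℤ) : ℝ :=
  ∑' y : ℤ, Ker s (y - x) * (f x - f y) ^ 2

/-- The squared modulus of the modified gradient,
`|∇̃f|²(x) = Σ_{y : |f y| < |f x|} K_s(y-x) (f x - f y)²`. -/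
noncomputable def mgradSq (s : ℝ) (f : ℤ → ℝ) (x : ℤ) : ℝ :=
  ∑' y : {y : ℤ // |f y| < |f x|}, Ker s ((y : ℤ) - x) * (f x - f (y : ℤ)) ^ 2

/-- The `ℓ^q` norm on `ℤ` with counting measure (for finite `q`). -/
noncomputable def lqNorm (q : ℝ) (f : ℤ → ℝ) : ℝ :=
  (∑' x : ℤ, |f x| ^ q) ^ (1 / q)

/-- The Schrödinger operator `L_U = L + M_U`, where `M_U` is multiplication by `U`. -/
noncomputable def LopU (s : ℝ) (U : ℤ → ℝ) (f : ℤ → ℝ) : ℤ → ℝ :=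
  fun x => Lop s f x + U x * f x

/-- The Schrödinger semigroup `P_t^U = exp (-t L_U)`, given by the exponential series of
the bounded operator `-t L_U` (evaluated pointwise). -/
noncomputable def heatU (s : ℝ) (U : ℤ → ℝ) (t : ℝ) (f : ℤ → ℝ) : ℤ → ℝ :=
  fun x => ∑' n : ℕ, ((-t) ^ n / (n.factorial : ℝ)) * ((LopU s U)^[n] f x)

section Kernel

variable {s : ℝ}

theorem Ker_neg (s : ℝ) (m : ℤ) : Ker s (-m) = Ker s m := by
  simp [Ker]

theorem Ker_const_nonneg (hs : s ∈ Set.Ioo (0 : ℝ) 1) :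
    0 ≤ (4 : ℝ) ^ s * Real.Gamma (1 / 2 + s) / (Real.sqrt Real.pi * |Real.Gamma (-s)|) := by
  have : 0 < Real.Gamma (1 / 2 + s) := Real.Gamma_pos_of_pos (by linarith [hs.1])
  positivity

theorem Gamma_ratio_nonneg (hs : s ∈ Set.Ioo (0 : ℝ) 1) (n : ℕ) :
    0 ≤ Real.Gamma ((n + 1 : ℝ) - s) / Real.Gamma ((n + 1 : ℝ) + 1 + s) := by
  have h1 : 0 < Real.Gamma ((n + 1 : ℝ) - s) :=
    Real.Gamma_pos_of_pos (by have := hs.2; have : (0 : ℝ) ≤ n := n.cast_nonneg; linarith)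
  have h2 : 0 < Real.Gamma ((n + 1 : ℝ) + 1 + s) :=
    Real.Gamma_pos_of_pos (by have := hs.1; positivity)
  positivity

theorem Ker_natCast_succ (s : ℝ) (n : ℕ) : Ker s ((n : ℤ) + 1) =
    ((4 : ℝ) ^ s * Real.Gamma (1 / 2 + s) / (Real.sqrt Real.pi * |Real.Gamma (-s)|)) *
    (Real.Gamma ((n + 1 : ℝ) - s) / Real.Gamma ((n + 1 : ℝ) + 1 + s)) := by
  have h : ((n : ℤ) + 1).natAbs = n + 1 := by omega
  have h0 : ((n : ℤ) + 1) ≠ 0 := by omega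
  simp only [Ker, h, h0, if_false]
  push_cast
  rfl

theorem Ker_nonneg (hs : s ∈ Set.Ioo (0 : ℝ) 1) (m : ℤ) : 0 ≤ Ker s m := by
  have key : ∀ n : ℕ, 0 ≤ Ker s (n : ℤ) := by
    intro n
    cases n with
    | zero => simp [Ker]
    | succ n =>
      push_cast
      rw [Ker_natCast_succ]
      exact mul_nonneg (Ker_const_nonneg hs) (Gamma_ratio_nonneg hs n)
  obtain ⟨n, rfl | rfl⟩ := m.eq_nat_or_neg
  · exact key n
  · rw [Ker_neg]; exact key n

theorem Ker_succ_le (hs : s ∈ Set.Ioo (0 : ℝ) 1) (n : ℕ) :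
    Ker s ((n : ℤ) + 1 + 1) ≤ Ker s ((n : ℤ) + 1) := by
  have h := Ker_natCast_succ s (n + 1)
  push_cast at h
  rw [h, Ker_natCast_succ]
  refine mul_le_mul_of_nonneg_left ?_ (Ker_const_nonneg hs)
  have hn : (0 : ℝ) ≤ n := n.cast_nonneg
  have h1 : 0 < (n : ℝ) + 1 - s := by linarith [hs.2]
  have h2 : 0 < (n : ℝ) + 1 + 1 + s := by linarith [hs.1]
  have e1 : (n : ℝ) + 1 + 1 - s = (n + 1 - s) + 1 := by ring
  have e2 : (n : ℝ) + 1 + 1 + 1 + s = (n + 1 + 1 + s) + 1 := by ring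
  rw [e1, e2, Real.Gamma_add_one h1.ne', Real.Gamma_add_one h2.ne', mul_div_mul_comm]
  refine mul_le_of_le_one_left (Gamma_ratio_nonneg hs n) ?_
  rw [div_le_one h2]
  linarith [hs.1]

theorem summable_Gamma_ratio (hs : s ∈ Set.Ioo (0 : ℝ) 1) :
    Summable fun n : ℕ => Real.Gamma ((n + 1 : ℝ) - s) / Real.Gamma ((n + 1 : ℝ) + 1 + s) := by
  set b : ℕ → ℝ := fun n => Real.Gamma ((n + 1 : ℝ) - s) / Real.Gamma ((n + 1 : ℝ) + s) with hb
  have hbnn : ∀ n, 0 ≤ b n := fun n => by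
    have hn : (0 : ℝ) ≤ n := n.cast_nonneg
    have h1 := Real.Gamma_pos_of_pos (show 0 < (n : ℝ) + 1 - s by linarith [hs.2])
    have h2 := Real.Gamma_pos_of_pos (show 0 < (n : ℝ) + 1 + s by linarith [hs.1])
    simp only [hb]; positivity
  have htel : ∀ n : ℕ, Real.Gamma ((n + 1 : ℝ) - s) / Real.Gamma ((n + 1 : ℝ) + 1 + s)
      = (1 / (2 * s)) * (b n - b (n + 1)) := by
    intro n
    have hn : (0 : ℝ) ≤ n := n.cast_nonneg
    have h1 : 0 < (n : ℝ) + 1 - s := by linarith [hs.2]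
    have h2 : 0 < (n : ℝ) + 1 + s := by linarith [hs.1]
    have g1 := Real.Gamma_pos_of_pos h1
    have g2 := Real.Gamma_pos_of_pos h2
    have e1 : (n : ℝ) + 1 + 1 - s = (n + 1 - s) + 1 := by ring
    have e2 : (n : ℝ) + 1 + 1 + s = (n + 1 + s) + 1 := by ring
    have hs0 := hs.1
    simp only [hb]
    push_cast
    rw [e1, e2, Real.Gamma_add_one h1.ne', Real.Gamma_add_one h2.ne']
    field_simp
    ring
  refine summable_of_sum_range_le (c := (1 / (2 * s)) * b 0) (Gamma_ratio_nonneg hs) fun n => ?_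
  simp_rw [htel]
  rw [← Finset.mul_sum, Finset.sum_range_sub']
  have := hs.1
  exact mul_le_mul_of_nonneg_left (by linarith [hbnn n]) (by positivity)

theorem summable_Ker (hs : s ∈ Set.Ioo (0 : ℝ) 1) : Summable (Ker s) := by
  have h : Summable fun n : ℕ => Ker s ((n : ℤ) + 1) := by
    simp_rw [Ker_natCast_succ]
    exact (summable_Gamma_ratio hs).mul_left _
  refine Summable.of_nat_of_neg_add_one ?_ ?_
  · rw [← summable_nat_add_iff 1]
    simpa using h
  · simpa only [Ker_neg] using h

end Kernel

section Maximal

/-- The largest value of `∑_{i < n} (g (x + i) - l)` over `0 ≤ n ≤ N`, computed recursively. -/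
noncomputable def excess (g : ℤ → ℝ) (l : ℝ) : ℕ → ℤ → ℝ
  | 0, _ => 0
  | N + 1, x => max 0 (g x - l + excess g l N (x + 1))

/-- The sum of `g` over the window `{x, …, x + n - 1}`. -/
noncomputable def windowSum (g : ℤ → ℝ) (n : ℕ) (x : ℤ) : ℝ := ∑ i ∈ Finset.range n, g (x + i)

/-- The one-sided maximal function over windows of length at most `N`. -/
noncomputable def maxAvg (g : ℤ → ℝ) : ℕ → ℤ → ℝ
  | 0, _ => 0
  | N + 1, x => max (maxAvg g N x) (windowSum g (N + 1) x / (N + 1))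

variable {g : ℤ → ℝ} {l : ℝ}

theorem windowSum_succ (g : ℤ → ℝ) (n : ℕ) (x : ℤ) :
    windowSum g (n + 1) x = g x + windowSum g n (x + 1) := by
  simp only [windowSum, Finset.sum_range_succ']
  rw [add_comm]
  congr 1
  · simp
  · refine Finset.sum_congr rfl fun i _ => ?_
    congr 1; push_cast; ring

theorem excess_nonneg (g : ℤ → ℝ) (l : ℝ) (N : ℕ) (x : ℤ) : 0 ≤ excess g l N x := by
  cases N with
  | zero => simp [excess]
  | succ N => simp [excess]

theorem excess_le_succ (g : ℤ → ℝ) (l : ℝ) (N : ℕ) (x : ℤ) :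
    excess g l N x ≤ excess g l (N + 1) x := by
  induction N generalizing x with
  | zero => exact excess_nonneg g l _ x
  | succ N ih => exact max_le_max le_rfl (by simpa [excess] using ih (x + 1))

theorem le_excess (g : ℤ → ℝ) (l : ℝ) {n N : ℕ} (hn : n ≤ N) (x : ℤ) :
    windowSum g n x - n * l ≤ excess g l N x := by
  induction N generalizing x n with
  | zero =>
    obtain rfl : n = 0 := by omega
    simp [excess, windowSum]
  | succ N ih =>
    cases n with
    | zero => simpa [windowSum] using excess_nonneg g l _ x
    | succ n =>
      have := ih (n := n) (by omega) (x + 1)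
      rw [windowSum_succ]
      refine le_trans ?_ (le_max_right _ _)
      push_cast
      linarith

theorem exists_excess_eq (g : ℤ → ℝ) (l : ℝ) (N : ℕ) (x : ℤ) :
    ∃ n ≤ N, excess g l N x = windowSum g n x - n * l := by
  induction N generalizing x with
  | zero => exact ⟨0, le_rfl, by simp [excess, windowSum]⟩
  | succ N ih =>
    rcases le_total (g x - l + excess g l N (x + 1)) 0 with h | h
    · exact ⟨0, by omega, by simp [excess, windowSum, h]⟩
    · obtain ⟨n, hn, he⟩ := ih (x + 1)
      refine ⟨n + 1, by omega, ?_⟩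
      rw [windowSum_succ, excess, max_eq_right h, he]
      push_cast; ring

theorem maxAvg_nonneg (g : ℤ → ℝ) (N : ℕ) (x : ℤ) : 0 ≤ maxAvg g N x := by
  induction N with
  | zero => simp [maxAvg]
  | succ N ih => exact ih.trans (le_max_left _ _)

theorem maxAvg_mono (g : ℤ → ℝ) (x : ℤ) : Monotone fun N => maxAvg g N x :=
  monotone_nat_of_le_succ fun _ => le_max_left _ _

theorem lt_maxAvg_iff (hl : 0 ≤ l) (N : ℕ) (x : ℤ) :
    l < maxAvg g N x ↔ ∃ n < N, l < windowSum g (n + 1) x / (n + 1) := by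
  induction N with
  | zero => simp [maxAvg, hl]
  | succ N ih =>
    rw [maxAvg, lt_max_iff, ih]
    constructor
    · rintro (⟨n, hn, h⟩ | h)
      · exact ⟨n, by omega, h⟩
      · exact ⟨N, by omega, h⟩
    · rintro ⟨n, hn, h⟩
      rcases Nat.lt_succ_iff_lt_or_eq.1 hn with hn | rfl
      · exact Or.inl ⟨n, hn, h⟩
      · exact Or.inr h

theorem lt_maxAvg_iff_excess_pos (hl : 0 ≤ l) (N : ℕ) (x : ℤ) :
    l < maxAvg g N x ↔ 0 < excess g l N x := by
  rw [lt_maxAvg_iff hl]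
  constructor
  · rintro ⟨n, hn, h⟩
    rw [lt_div_iff₀ (by positivity)] at h
    refine lt_of_lt_of_le ?_ (le_excess g l (n := n + 1) hn x)
    push_cast
    linarith
  · intro h
    obtain ⟨n, hn, he⟩ := exists_excess_eq g l N x
    cases n with
    | zero => simp [he, windowSum] at h
    | succ n =>
      refine ⟨n, hn, ?_⟩
      rw [lt_div_iff₀ (by positivity)]
      rw [he] at h
      push_cast at h
      linarith

theorem summable_excess (hg : ∀ x, 0 ≤ g x) (hs : Summable g) (hl : 0 ≤ l) (N : ℕ) :
    Summable (excess g l N) := by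
  induction N with
  | zero => exact summable_zero
  | succ N ih =>
    refine Summable.of_nonneg_of_le (fun x => excess_nonneg g l _ x) (fun x => ?_)
      (hs.add ((Equiv.addRight (1 : ℤ)).summable_iff.2 ih))
    refine max_le (add_nonneg (hg x) (excess_nonneg g l _ _)) ?_
    simp only [Function.comp, Equiv.coe_addRight]
    linarith

/-- The maximal ergodic inequality for the shift on `ℤ`. -/
theorem tsum_indicator_excess_le (hg : ∀ x, 0 ≤ g x) (hs : Summable g) (hl : 0 ≤ l) (N : ℕ) :
    Summable (Set.indicator {x | 0 < excess g l N x} fun _ => l) ∧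
    ∑' x, Set.indicator {x | 0 < excess g l N x} (fun _ => l) x
      ≤ ∑' x, Set.indicator {x | 0 < excess g l N x} g x := by
  have hF := summable_excess hg hs hl N
  have hF1 : Summable fun x => excess g l N (x + 1) :=
    (Equiv.addRight (1 : ℤ)).summable_iff.2 hF
  have hFe : ∑' x, excess g l N (x + 1) = ∑' x, excess g l N x :=
    (Equiv.addRight (1 : ℤ)).tsum_eq (excess g l N)
  have hgi := hs.indicator {x | 0 < excess g l N x}
  have hle : ∀ x, Set.indicator {x | 0 < excess g l N x} (fun _ => l) x ≤
      Set.indicator {x | 0 < excess g l N x} g x + (excess g l N (x + 1) - excess g l N x) := by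
    intro x
    by_cases hx : 0 < excess g l N x
    · rw [Set.indicator_of_mem (show x ∈ {x | 0 < excess g l N x} from hx),
        Set.indicator_of_mem (show x ∈ {x | 0 < excess g l N x} from hx)]
      cases N with
      | zero => simp [excess] at hx
      | succ N =>
        have h1 : excess g l (N + 1) x = g x - l + excess g l N (x + 1) := by
          rw [excess] at hx ⊢
          rcases lt_max_iff.1 hx with h | h
          · exact absurd h (lt_irrefl _)
          · exact max_eq_right h.le
        have h2 := excess_le_succ g l N (x + 1)
        linarith
    · rw [Set.indicator_of_notMem (show x ∉ {x | 0 < excess g l N x} from hx),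
        Set.indicator_of_notMem (show x ∉ {x | 0 < excess g l N x} from hx)]
      have := excess_nonneg g l N (x + 1)
      linarith [not_lt.1 hx]
  have hR := hgi.add (hF1.sub hF)
  have hL : Summable (Set.indicator {x | 0 < excess g l N x} fun _ => l) :=
    Summable.of_nonneg_of_le (fun x => Set.indicator_nonneg (fun _ _ => hl) x) hle hR
  refine ⟨hL, (hL.tsum_le_tsum hle hR).trans_eq ?_⟩
  rw [hgi.tsum_add (hF1.sub hF), hF1.tsum_sub hF, hFe, sub_self, add_zero]

theorem mul_count_maxAvg_le (hg : ∀ x, 0 ≤ g x) (hs : Summable g) (hl : 0 ≤ l) (N : ℕ) :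
    ENNReal.ofReal l * Measure.count {x | l < maxAvg g N x} ≤
      (Measure.count.withDensity fun x => ENNReal.ofReal (g x)) {x | l < maxAvg g N x} := by
  have hset : {x | l < maxAvg g N x} = {x | 0 < excess g l N x} := by
    ext x; exact lt_maxAvg_iff_excess_pos hl N x
  rw [hset]
  obtain ⟨h1, h2⟩ := tsum_indicator_excess_le hg hs hl N
  set E := {x | 0 < excess g l N x}
  have hE : MeasurableSet E := (Set.to_countable E).measurableSet
  have hcoe : ∀ f : ℤ → ℝ, (E.indicator fun x => ENNReal.ofReal (f x))
      = fun x => ENNReal.ofReal (E.indicator f x) := fun f => by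
    ext x
    by_cases hx : x ∈ E <;> simp [hx]
  rw [withDensity_apply _ hE, ← setLIntegral_const, ← lintegral_indicator hE,
    ← lintegral_indicator hE, hcoe fun _ => l, hcoe, lintegral_count, lintegral_count,
    ← ENNReal.ofReal_tsum_of_nonneg (Set.indicator_nonneg fun _ _ => hl) h1,
    ← ENNReal.ofReal_tsum_of_nonneg (Set.indicator_nonneg fun x _ => hg x) (hs.indicator E)]
  exact ENNReal.ofReal_le_ofReal h2

theorem lintegral_maxAvg_rpow_le_mul (hg : ∀ x, 0 ≤ g x) (hs : Summable g) {q : ℝ} (hq : 1 < q)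
    (N : ℕ) :
    ∫⁻ x, ENNReal.ofReal (maxAvg g N x ^ q) ∂Measure.count ≤ ENNReal.ofReal (q / (q - 1)) *
      ∫⁻ x, ENNReal.ofReal (g x) * ENNReal.ofReal (maxAvg g N x ^ (q - 1)) ∂Measure.count := by
  have hm : ∀ f : ℤ → ENNReal, Measurable f := fun f => measurable_of_countable f
  have hm' : ∀ f : ℤ → ℝ, Measurable f := fun f => measurable_of_countable f
  have e2 : ∫⁻ x, ENNReal.ofReal (g x) * ENNReal.ofReal (maxAvg g N x ^ (q - 1)) ∂Measure.count
      = ∫⁻ x, ENNReal.ofReal (maxAvg g N x ^ (q - 1))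
        ∂(Measure.count.withDensity fun x => ENNReal.ofReal (g x)) := by
    rw [lintegral_withDensity_eq_lintegral_mul _ (hm _) (hm _)]
    rfl
  rw [e2, lintegral_rpow_eq_lintegral_meas_lt_mul _ (.of_forall (maxAvg_nonneg g N))
      (hm' _).aemeasurable (by linarith),
    lintegral_rpow_eq_lintegral_meas_lt_mul _ (.of_forall (maxAvg_nonneg g N))
      (hm' _).aemeasurable (by linarith), ← mul_assoc,
    ← ENNReal.ofReal_mul (by have : 0 < q - 1 := by linarith
                             positivity),
    div_mul_cancel₀ _ (by linarith)]
  gcongr ENNReal.ofReal q * ?_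
  refine setLIntegral_mono' measurableSet_Ioi fun t (ht : 0 < t) => ?_
  have e3 : ENNReal.ofReal (t ^ (q - 1)) = ENNReal.ofReal t * ENNReal.ofReal (t ^ (q - 1 - 1)) := by
    rw [← ENNReal.ofReal_mul ht.le]
    congr 1
    rw [Real.rpow_sub_one ht.ne' (q - 1)]
    field_simp
  rw [e3, ← mul_assoc]
  gcongr ?_ * _
  rw [mul_comm]
  exact mul_count_maxAvg_le hg hs ht.le N

theorem summable_windowSum (hs : Summable g) (n : ℕ) : Summable (windowSum g n) :=
  summable_sum fun i _ => (Equiv.addRight (i : ℤ)).summable_iff.2 hs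

theorem summable_maxAvg (hg : ∀ x, 0 ≤ g x) (hs : Summable g) (N : ℕ) :
    Summable (maxAvg g N) := by
  induction N with
  | zero => exact summable_zero
  | succ N ih =>
    refine Summable.of_nonneg_of_le (fun x => maxAvg_nonneg g _ x) (fun x => ?_)
      (ih.add ((summable_windowSum hs (N + 1)).div_const (N + 1)))
    have h : 0 ≤ windowSum g (N + 1) x / (N + 1) :=
      div_nonneg (Finset.sum_nonneg fun _ _ => hg _) (by positivity)
    exact max_le (by linarith) (by linarith [maxAvg_nonneg g N x])

theorem Summable.rpow_of_one_le {f : ℤ → ℝ} (hf : ∀ x, 0 ≤ f x) (hs : Summable f) {q : ℝ}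
    (hq : 1 ≤ q) : Summable fun x => f x ^ q := by
  have hev : ∀ᶠ x in Filter.cofinite, f x ≤ 1 :=
    (hs.tendsto_cofinite_zero.eventually (ge_mem_nhds zero_lt_one))
  refine Summable.of_norm_bounded_eventually hs ?_
  filter_upwards [hev] with x hx
  rw [Real.norm_of_nonneg (Real.rpow_nonneg (hf x) q)]
  exact Real.rpow_le_self_of_le_one (hf x) hx hq

theorem ENNReal.le_of_le_mul_rpow {X Y c : ENNReal} {q : ℝ} (hq : 1 < q) (hX : X ≠ ⊤)
    (h : X ≤ c * (Y ^ (1 / q) * X ^ (1 - 1 / q))) : X ≤ c ^ q * Y := by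
  have hq0 : 0 < q := by linarith
  rcases eq_or_ne X 0 with rfl | h0
  · exact zero_le
  have hp0 : X ^ (1 - 1 / q) ≠ 0 := by simp [ENNReal.rpow_eq_zero_iff, h0, hX]
  have hpt : X ^ (1 - 1 / q) ≠ ⊤ := by simp [ENNReal.rpow_eq_top_iff, h0, hX]
  have h1 : X ^ (1 / q) ≤ c * Y ^ (1 / q) := by
    rw [← ENNReal.mul_le_mul_iff_left hp0 hpt, ← ENNReal.rpow_add _ _ h0 hX, mul_assoc]
    simpa using h
  have h2 := ENNReal.rpow_le_rpow h1 hq0.le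
  rwa [ENNReal.mul_rpow_of_nonneg _ _ hq0.le, ← ENNReal.rpow_mul, ← ENNReal.rpow_mul,
    one_div_mul_cancel hq0.ne', ENNReal.rpow_one, ENNReal.rpow_one] at h2

theorem lintegral_maxAvg_rpow_le (hg : ∀ x, 0 ≤ g x) (hs : Summable g) {q : ℝ} (hq : 1 < q)
    (N : ℕ) :
    ∫⁻ x, ENNReal.ofReal (maxAvg g N x ^ q) ∂Measure.count ≤
      ENNReal.ofReal (q / (q - 1)) ^ q * ∫⁻ x, ENNReal.ofReal (g x ^ q) ∂Measure.count := by
  have hm : ∀ f : ℤ → ENNReal, Measurable f := fun f => measurable_of_countable f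
  have hq0 : 0 < q := by linarith
  refine ENNReal.le_of_le_mul_rpow hq ?_ ?_
  · rw [lintegral_count, ← ENNReal.ofReal_tsum_of_nonneg
      (fun x => Real.rpow_nonneg (maxAvg_nonneg g N x) q)
      (Summable.rpow_of_one_le (maxAvg_nonneg g N) (summable_maxAvg hg hs N) hq.le)]
    exact ENNReal.ofReal_ne_top
  · refine (lintegral_maxAvg_rpow_le_mul hg hs hq N).trans ?_
    gcongr _ * ?_
    refine le_trans (le_of_eq ?_) (ENNReal.lintegral_mul_norm_pow_le (hm _).aemeasurable
      (hm _).aemeasurable (by positivity) (sub_nonneg.2 ?_) (add_sub_cancel _ _))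
    · refine lintegral_congr fun x => ?_
      have := maxAvg_nonneg g N x
      rw [ENNReal.ofReal_rpow_of_nonneg (Real.rpow_nonneg (hg x) q) (by positivity),
        ENNReal.ofReal_rpow_of_nonneg (Real.rpow_nonneg this q)
          (sub_nonneg.2 ((div_le_one hq0).2 hq.le)), ← Real.rpow_mul (hg x), ← Real.rpow_mul this]
      congr 3
      · field_simp; simp
      · field_simp
    · exact (div_le_one hq0).2 hq.le

/-- The one-sided maximal function over all windows. -/
noncomputable def maxFun (g : ℤ → ℝ) (x : ℤ) : ENNReal := ⨆ N, ENNReal.ofReal (maxAvg g N x)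

theorem tsum_maxFun_rpow_le (hg : ∀ x, 0 ≤ g x) (hs : Summable g) {q : ℝ} (hq : 1 < q) :
    ∑' x, maxFun g x ^ q ≤
      ENNReal.ofReal (q / (q - 1)) ^ q * ∑' x, ENNReal.ofReal (g x ^ q) := by
  have hq0 : 0 < q := by linarith
  have hm : ∀ f : ℤ → ENNReal, Measurable f := fun f => measurable_of_countable f
  have e : ∀ x, maxFun g x ^ q = ⨆ N, ENNReal.ofReal (maxAvg g N x ^ q) := fun x => by
    rw [maxFun, ← ENNReal.orderIsoRpow_apply q hq0, OrderIso.map_iSup]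
    simp only [ENNReal.orderIsoRpow_apply]
    exact iSup_congr fun N => ENNReal.ofReal_rpow_of_nonneg (maxAvg_nonneg g N x) hq0.le
  rw [← lintegral_count, ← lintegral_count]
  simp_rw [e]
  rw [lintegral_iSup (fun N => hm _)]
  · exact iSup_le fun N => lintegral_maxAvg_rpow_le hg hs hq N
  · intro N N' hN x
    exact ENNReal.ofReal_le_ofReal
      (Real.rpow_le_rpow (maxAvg_nonneg g N x) (maxAvg_mono g x hN) hq0.le)

theorem ofReal_windowSum_le (g : ℤ → ℝ) (n : ℕ) (x : ℤ) :
    ENNReal.ofReal (windowSum g (n + 1) x) ≤ (n + 1) * maxFun g x := by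
  have h : windowSum g (n + 1) x ≤ (n + 1) * maxAvg g (n + 1) x := by
    have : windowSum g (n + 1) x / (n + 1) ≤ maxAvg g (n + 1) x := le_max_right _ _
    rwa [div_le_iff₀' (by positivity)] at this
  refine (ENNReal.ofReal_le_ofReal h).trans ?_
  rw [ENNReal.ofReal_mul (by positivity)]
  gcongr
  · rw [ENNReal.ofReal_add (by positivity) zero_le_one]; simp
  · exact le_iSup (fun N => ENNReal.ofReal (maxAvg g N x)) (n + 1)

/-- The two-sided maximal function. -/
noncomputable def maxFun₂ (g : ℤ → ℝ) (x : ℤ) : ENNReal :=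
  maxFun g x + maxFun (fun y => g (-y)) (-x)

theorem tsum_maxFun₂_rpow_le (hg : ∀ x, 0 ≤ g x) (hs : Summable g) {q : ℝ} (hq : 1 < q) :
    ∑' x, maxFun₂ g x ^ q ≤ 2 ^ (q - 1) * (2 * ENNReal.ofReal (q / (q - 1)) ^ q) *
      ∑' x, ENNReal.ofReal (g x ^ q) := by
  have hs' : Summable fun y => g (-y) := (Equiv.neg ℤ).summable_iff.2 hs
  have e1 : ∑' x, maxFun (fun y => g (-y)) (-x) ^ q = ∑' x, maxFun (fun y => g (-y)) x ^ q :=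
    (Equiv.neg ℤ).tsum_eq fun x => maxFun (fun y => g (-y)) x ^ q
  have e2 : ∑' x, ENNReal.ofReal (g (-x) ^ q) = ∑' x, ENNReal.ofReal (g x ^ q) :=
    (Equiv.neg ℤ).tsum_eq fun x => ENNReal.ofReal (g x ^ q)
  calc ∑' x, maxFun₂ g x ^ q
      ≤ ∑' x, 2 ^ (q - 1) * (maxFun g x ^ q + maxFun (fun y => g (-y)) (-x) ^ q) :=
        ENNReal.tsum_le_tsum fun x => ENNReal.rpow_add_le_mul_rpow_add_rpow _ _ hq.le
    _ ≤ _ := by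
        rw [ENNReal.tsum_mul_left, ENNReal.tsum_add, e1, mul_assoc]
        gcongr _ * ?_
        have h1 := tsum_maxFun_rpow_le hg hs hq
        have h2 := tsum_maxFun_rpow_le (fun x => hg (-x)) hs' hq
        rw [e2] at h2
        rw [two_mul, add_mul]
        exact add_le_add h1 h2

end Maximal

section SymmDecr

/-- Summable symmetric weights on `ℤ` which are nonincreasing on `ℕ`. -/
structure SymmDecr (ν : ℤ → ENNReal) : Prop where
  symm : ∀ m, ν (-m) = ν m
  succ_le : ∀ n : ℕ, ν ((n : ℤ) + 1) ≤ ν n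
  tsum_ne_top : ∑' m, ν m ≠ ⊤

theorem SymmDecr.le_of_natAbs_le {ν : ℤ → ENNReal} (hν : SymmDecr ν) {i j : ℤ}
    (h : i.natAbs ≤ j.natAbs) : ν j ≤ ν i := by
  have key : ∀ m : ℤ, ν m = ν (m.natAbs : ℤ) := fun m => by
    rcases m.natAbs_eq with h | h
    · rw [← h]
    · conv_lhs => rw [h]
      exact hν.symm _
  have hanti : Antitone fun n : ℕ => ν n := antitone_nat_of_succ_le fun n => by
    exact_mod_cast hν.succ_le n
  rw [key i, key j]
  exact hanti h

theorem sum_Icc_neg_le (a : ℤ → ENNReal) (k : ℕ) :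
    ∑ m ∈ Finset.Icc (-(k : ℤ)) k, a m ≤
      ∑ i ∈ Finset.range (k + 1), a i + ∑ i ∈ Finset.range (k + 1), a (-i) := by
  have hsub : Finset.Icc (-(k : ℤ)) k ⊆ (Finset.range (k + 1)).image (fun i : ℕ => (i : ℤ)) ∪
      (Finset.range (k + 1)).image (fun i : ℕ => -(i : ℤ)) := by
    intro m hm
    rw [Finset.mem_Icc] at hm
    simp only [Finset.mem_union, Finset.mem_image, Finset.mem_range]
    rcases le_total 0 m with h | h
    · exact Or.inl ⟨m.toNat, by omega, by omega⟩
    · exact Or.inr ⟨(-m).toNat, by omega, by omega⟩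
  refine (Finset.sum_le_sum_of_subset hsub).trans ?_
  refine (self_le_add_right _ _).trans_eq (Finset.sum_union_inter.trans ?_)
  rw [Finset.sum_image (by simp), Finset.sum_image (by simp)]

theorem sum_Icc_le_maxFun₂ {g : ℤ → ℝ} (hg : ∀ x, 0 ≤ g x) (x : ℤ) (k : ℕ) :
    ∑ m ∈ Finset.Icc (-(k : ℤ)) k, ENNReal.ofReal (g (x + m)) ≤ (2 * k + 1) * maxFun₂ g x := by
  refine (sum_Icc_neg_le _ k).trans ?_
  have h1 := ofReal_windowSum_le g k x
  have h2 := ofReal_windowSum_le (fun y => g (-y)) k (-x)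
  simp only [windowSum] at h1 h2
  rw [ENNReal.ofReal_sum_of_nonneg fun _ _ => hg _] at h1 h2
  simp only [neg_add, neg_neg] at h2
  calc _ ≤ (k + 1) * maxFun g x + (k + 1) * maxFun (fun y => g (-y)) (-x) := add_le_add h1 h2
    _ = (k + 1) * maxFun₂ g x := by rw [maxFun₂, mul_add]
    _ ≤ _ := by
      gcongr
      exact_mod_cast Nat.le_mul_of_pos_left k two_pos

theorem SymmDecr.tsum_mul_le {ν : ℤ → ENNReal} (hν : SymmDecr ν) {g : ℤ → ℝ}
    (hg : ∀ x, 0 ≤ g x) (x : ℤ) :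
    ∑' m, ν m * ENNReal.ofReal (g (x + m)) ≤ (∑' m, ν m) * maxFun₂ g x := by
  have hm : ∀ f : ℤ → ENNReal, Measurable f := fun f => measurable_of_countable f
  have hm' : ∀ f : ℤ → ℝ, Measurable f := fun f => measurable_of_countable f
  set a : ℤ → ENNReal := fun m => ENNReal.ofReal (g (x + m)) with ha
  have hνf : ∀ m, ENNReal.ofReal (ν m).toReal = ν m := fun m =>
    ENNReal.ofReal_toReal (ENNReal.ne_top_of_tsum_ne_top hν.tsum_ne_top m)
  have hsum : Summable fun m => (ν m).toReal := ENNReal.summable_toReal hν.tsum_ne_top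
  have e1 : ∑' m, ν m * a m
      = ∫⁻ m, ENNReal.ofReal (ν m).toReal ∂(Measure.count.withDensity a) := by
    rw [lintegral_withDensity_eq_lintegral_mul _ (hm _) (hm _), lintegral_count]
    simp only [Pi.mul_apply, hνf, mul_comm]
  have e2 : ∑' m, ν m = ∫⁻ m, ENNReal.ofReal (ν m).toReal ∂Measure.count := by
    rw [lintegral_count]; simp only [hνf]
  rw [e1, e2, lintegral_eq_lintegral_meas_lt _ (.of_forall fun _ => ENNReal.toReal_nonneg)
      (hm' _).aemeasurable,
    lintegral_eq_lintegral_meas_lt _ (.of_forall fun _ => ENNReal.toReal_nonneg)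
      (hm' _).aemeasurable]
  have hmeas : Measurable fun t : ℝ => Measure.count {m | t < (ν m).toReal} :=
    Antitone.measurable fun t t' htt' =>
      measure_mono fun m (hm : t' < _) => lt_of_le_of_lt htt' hm
  rw [← lintegral_mul_const _ hmeas]
  refine setLIntegral_mono' measurableSet_Ioi fun t (ht : 0 < t) => ?_
  set S : Set ℤ := {m | t < (ν m).toReal} with hS
  have hfin : S.Finite := by
    have := hsum.tendsto_cofinite_zero.eventually (gt_mem_nhds ht)
    rw [Filter.eventually_cofinite] at this
    exact this.subset fun m hm => not_lt.2 (le_of_lt hm)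
  rcases S.eq_empty_or_nonempty with hE | hE
  · simp [hE]
  obtain ⟨b, hb, hbmax⟩ := Set.exists_max_image S Int.natAbs hfin hE
  have hSI : S = (Finset.Icc (-(b.natAbs : ℤ)) b.natAbs : Finset ℤ) := by
    ext m
    simp only [Finset.coe_Icc, Set.mem_Icc]
    constructor
    · intro h
      have := hbmax m h
      omega
    · intro h
      have h1 : ν b ≤ ν m := hν.le_of_natAbs_le (by omega)
      exact lt_of_lt_of_le hb
        (ENNReal.toReal_mono (ENNReal.ne_top_of_tsum_ne_top hν.tsum_ne_top m) h1)
  rw [hSI, withDensity_apply _ (Finset.measurableSet _), lintegral_finset,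
    Measure.count_apply_finset]
  simp only [Measure.count_singleton, mul_one]
  refine (sum_Icc_le_maxFun₂ hg x b.natAbs).trans (le_of_eq ?_)
  congr 1
  rw [Int.card_Icc, show ((b.natAbs : ℤ) + 1 - -(b.natAbs : ℤ)).toNat = 2 * b.natAbs + 1 by omega]
  push_cast; rfl

/-- Convolution of nonnegative functions on `ℤ`. -/
noncomputable def zconv (κ ν : ℤ → ENNReal) (m : ℤ) : ENNReal := ∑' j, κ (m - j) * ν j

theorem tsum_zconv (κ ν : ℤ → ENNReal) : ∑' m, zconv κ ν m = (∑' m, κ m) * ∑' m, ν m := by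
  simp only [zconv]
  rw [ENNReal.tsum_comm]
  simp_rw [ENNReal.tsum_mul_right]
  rw [← ENNReal.tsum_mul_left]
  exact tsum_congr fun j => by
    rw [← (Equiv.subRight j).tsum_eq κ]; rfl

theorem ENNReal.mul_add_mul_le_of_le {a b c d : ENNReal} (hab : b ≤ a) (hcd : d ≤ c) :
    a * d + b * c ≤ a * c + b * d := by
  obtain ⟨e, rfl⟩ := exists_add_of_le hcd
  rw [mul_add, mul_add, add_assoc, add_comm (b * d)]
  gcongr

theorem SymmDecr.conv {κ ν : ℤ → ENNReal} (hκ : SymmDecr κ) (hν : SymmDecr ν) :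
    SymmDecr (zconv κ ν) where
  symm m := by
    simp only [zconv]
    rw [← (Equiv.neg ℤ).tsum_eq]
    refine tsum_congr fun j => ?_
    simp only [Equiv.neg_apply]
    rw [hν.symm, ← hκ.symm]
    congr 2; ring
  tsum_ne_top := by
    rw [tsum_zconv]
    exact ENNReal.mul_ne_top hκ.tsum_ne_top hν.tsum_ne_top
  succ_le n := by
    have e : zconv κ ν ((n : ℤ) + 1) = ∑' j, κ (n - j) * ν (j + 1) := by
      simp only [zconv]
      rw [← (Equiv.addRight (1 : ℤ)).tsum_eq]
      refine tsum_congr fun j => ?_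
      simp only [Equiv.coe_addRight]
      congr 2; ring
    rw [e, zconv, tsum_of_nat_of_neg_add_one ENNReal.summable ENNReal.summable,
      tsum_of_nat_of_neg_add_one ENNReal.summable ENNReal.summable, ← ENNReal.tsum_add,
      ← ENNReal.tsum_add]
    refine ENNReal.tsum_le_tsum fun i => ?_
    have h1 : ν (-((i : ℤ) + 1) + 1) = ν i := by
      rw [← hν.symm]; congr 1; ring
    rw [h1, hν.symm]
    exact ENNReal.mul_add_mul_le_of_le (hκ.le_of_natAbs_le (by omega)) (hν.succ_le i)

theorem SymmDecr.tsum_mul_iterate_le {κ : ℤ → ENNReal} (hκ : SymmDecr κ) {h : ℕ → ℤ → ℝ}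
    (hh : ∀ n x, ‖h (n + 1) x‖ₑ ≤ ∑' y, κ (x - y) * ‖h n y‖ₑ) (n : ℕ) {ν : ℤ → ENNReal}
    (hν : SymmDecr ν) (x : ℤ) :
    ∑' y, ν (y - x) * ‖h n y‖ₑ ≤
      (∑' m, κ m) ^ n * ((∑' m, ν m) * maxFun₂ (fun y => |h 0 y|) x) := by
  induction n generalizing ν with
  | zero =>
    rw [pow_zero, one_mul]
    refine le_trans (le_of_eq ?_) (hν.tsum_mul_le (fun y => abs_nonneg (h 0 y)) x)
    rw [← (Equiv.addLeft x).tsum_eq]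
    refine tsum_congr fun j => ?_
    simp only [Equiv.coe_addLeft]
    rw [add_sub_cancel_left, Real.enorm_eq_ofReal_abs]
  | succ n ih =>
    calc ∑' y, ν (y - x) * ‖h (n + 1) y‖ₑ
        ≤ ∑' y, ν (y - x) * ∑' z, κ (y - z) * ‖h n z‖ₑ :=
          ENNReal.tsum_le_tsum fun y => by gcongr; exact hh n y
      _ = ∑' z, zconv κ ν (z - x) * ‖h n z‖ₑ := by
          simp_rw [← ENNReal.tsum_mul_left]
          rw [ENNReal.tsum_comm]
          refine tsum_congr fun z => ?_
          rw [zconv, ← ENNReal.tsum_mul_right, ← (Equiv.addRight x).tsum_eq]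
          refine tsum_congr fun y => ?_
          simp only [Equiv.coe_addRight]
          rw [← hκ.symm, add_sub_cancel_right, ← mul_assoc, mul_comm (ν y)]
          congr 3; ring
      _ ≤ _ := ih (hκ.conv hν)
      _ = _ := by rw [tsum_zconv]; ring

theorem SymmDecr.enorm_iterate_le {κ : ℤ → ENNReal} (hκ : SymmDecr κ) {h : ℕ → ℤ → ℝ}
    (hh : ∀ n x, ‖h (n + 1) x‖ₑ ≤ ∑' y, κ (x - y) * ‖h n y‖ₑ) (n : ℕ) (x : ℤ) :
    ‖h n x‖ₑ ≤ (∑' m, κ m) ^ n * maxFun₂ (fun y => |h 0 y|) x := by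
  have hδ : SymmDecr (Pi.single 0 1) :=
    ⟨fun m => by simp [Pi.single_apply], fun n => by
      rw [Pi.single_eq_of_ne (by omega)]; exact zero_le, by simp [tsum_pi_single]⟩
  have := hκ.tsum_mul_iterate_le hh n hδ x
  rw [tsum_pi_single, one_mul, tsum_eq_single x] at this
  · simpa using this
  · intro y hy
    rw [Pi.single_eq_of_ne (sub_ne_zero.2 hy), zero_mul]

end SymmDecr

section Operator

theorem summable_iff_tsum_enorm {f : ℤ → ℝ} : Summable f ↔ ∑' x, ‖f x‖ₑ ≠ ⊤ := by
  rw [← summable_norm_iff]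
  constructor
  · intro h
    have := h.tsum_ofReal_ne_top
    simpa only [ofReal_norm] using this
  · intro h
    have := ENNReal.summable_toReal h
    simpa only [toReal_enorm] using this

/-- The Banach space `ℓ¹(ℤ)`. -/
abbrev EllOne := lp (fun _ : ℤ => ℝ) 1

theorem EllOne.summable (f : EllOne) : Summable (f : ℤ → ℝ) := by
  have := (memℓp_gen_iff (by simp)).1 (lp.memℓp f)
  simpa [summable_abs_iff] using this

/-- The element of `ℓ¹(ℤ)` given by a summable function. -/
noncomputable def EllOne.mk (f : ℤ → ℝ) (hf : Summable f) : EllOne :=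
  ⟨f, memℓp_gen (by simpa [summable_abs_iff] using hf)⟩

theorem EllOne.enorm_eq (f : EllOne) : ‖f‖ₑ = ∑' x, ‖f x‖ₑ := by
  have h : ‖f‖ = ∑' x, ‖f x‖ := by
    rw [lp.norm_eq_tsum_rpow (by simp)]; simp
  rw [← ofReal_norm, h, ENNReal.ofReal_tsum_of_nonneg (fun _ => norm_nonneg _)
    (EllOne.summable f).norm]
  simp only [ofReal_norm]

variable {s : ℝ} {U : ℤ → ℝ}

theorem summable_Ker_sub (hs : s ∈ Set.Ioo (0 : ℝ) 1) (x : ℤ) :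
    Summable fun y => Ker s (x - y) :=
  (summable_Ker hs).comp_injective sub_right_injective

theorem tsum_Ker_sub (s : ℝ) (x : ℤ) : ∑' y, Ker s (x - y) = ∑' m, Ker s m :=
  (Equiv.subLeft x).tsum_eq (Ker s)

theorem Ker_le_tsum (hs : s ∈ Set.Ioo (0 : ℝ) 1) (m : ℤ) : Ker s m ≤ ∑' m, Ker s m :=
  (summable_Ker hs).le_tsum m fun _ _ => Ker_nonneg hs _

theorem summable_Ker_mul (hs : s ∈ Set.Ioo (0 : ℝ) 1) {f : ℤ → ℝ} (hf : Summable f) (x : ℤ) :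
    Summable fun y => Ker s (x - y) * f y := by
  refine Summable.of_norm_bounded (hf.norm.mul_left (∑' m, Ker s m)) fun y => ?_
  rw [norm_mul, Real.norm_of_nonneg (Ker_nonneg hs _)]
  exact mul_le_mul_of_nonneg_right (Ker_le_tsum hs _) (norm_nonneg _)

theorem LopU_eq (hs : s ∈ Set.Ioo (0 : ℝ) 1) {f : ℤ → ℝ} (hf : Summable f) (x : ℤ) :
    LopU s U f x = (∑' m, Ker s m + U x) * f x - ∑' y, Ker s (x - y) * f y := by
  have : Lop s f x = (∑' m, Ker s m) * f x - ∑' y, Ker s (x - y) * f y := by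
    rw [Lop, ← tsum_Ker_sub s x, ← tsum_mul_right,
      ← ((summable_Ker_sub hs x).mul_right _).tsum_sub (summable_Ker_mul hs hf x)]
    exact tsum_congr fun y => by ring
  rw [LopU, this]; ring

theorem enorm_tsum_Ker_mul_le (s : ℝ) (f : ℤ → ℝ) (x : ℤ) :
    ‖∑' y, Ker s (x - y) * f y‖ₑ ≤ ∑' y, ‖Ker s (x - y)‖ₑ * ‖f y‖ₑ :=
  enorm_tsum_le_tsum_enorm.trans_eq (tsum_congr fun _ => enorm_mul _ _)

theorem tsum_enorm_LopU_le (hs : s ∈ Set.Ioo (0 : ℝ) 1) (hU : ∀ x, 0 ≤ U x) {M : ℝ}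
    (hM : ∀ x, U x ≤ M) {f : ℤ → ℝ} (hf : Summable f) :
    ∑' x, ‖LopU s U f x‖ₑ ≤ ENNReal.ofReal (2 * ∑' m, Ker s m + M) * ∑' x, ‖f x‖ₑ := by
  have hA : 0 ≤ ∑' m, Ker s m := tsum_nonneg (Ker_nonneg hs)
  have hM0 : 0 ≤ M := (hU 0).trans (hM 0)
  have hK : ∀ y, ∑' x, ‖Ker s (x - y)‖ₑ = ENNReal.ofReal (∑' m, Ker s m) := fun y => by
    have h : ∑' x, ‖Ker s (x - y)‖ₑ = ∑' m, ‖Ker s m‖ₑ :=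
      (Equiv.subRight y).tsum_eq fun m => ‖Ker s m‖ₑ
    rw [h,
      ENNReal.ofReal_tsum_of_nonneg (Ker_nonneg hs) (summable_Ker hs)]
    exact tsum_congr fun m => Real.enorm_of_nonneg (Ker_nonneg hs m)
  calc ∑' x, ‖LopU s U f x‖ₑ
      ≤ ∑' x, (ENNReal.ofReal (∑' m, Ker s m + M) * ‖f x‖ₑ
          + ∑' y, ‖Ker s (x - y)‖ₑ * ‖f y‖ₑ) := by
        refine ENNReal.tsum_le_tsum fun x => ?_
        rw [LopU_eq hs hf]
        refine enorm_sub_le.trans (add_le_add ?_ (enorm_tsum_Ker_mul_le s f x))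
        rw [enorm_mul, Real.enorm_of_nonneg (add_nonneg hA (hU x))]
        gcongr
        exact hM x
    _ = _ := by
        rw [ENNReal.tsum_add, ENNReal.tsum_mul_left, ENNReal.tsum_comm]
        simp_rw [ENNReal.tsum_mul_right, hK]
        rw [ENNReal.tsum_mul_left, ← add_mul, ← ENNReal.ofReal_add (by positivity) hA]
        congr 2; ring

theorem summable_LopU (hs : s ∈ Set.Ioo (0 : ℝ) 1) (hU : ∀ x, 0 ≤ U x) {M : ℝ}
    (hM : ∀ x, U x ≤ M) {f : ℤ → ℝ} (hf : Summable f) : Summable (LopU s U f) := by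
  rw [summable_iff_tsum_enorm]
  refine ne_top_of_le_ne_top ?_ (tsum_enorm_LopU_le hs hU hM hf)
  exact ENNReal.mul_ne_top ENNReal.ofReal_ne_top (summable_iff_tsum_enorm.1 hf)

theorem LopU_add (hs : s ∈ Set.Ioo (0 : ℝ) 1) {f g : ℤ → ℝ} (hf : Summable f) (hg : Summable g) :
    LopU s U (f + g) = LopU s U f + LopU s U g := by
  ext x
  rw [Pi.add_apply, LopU_eq hs hf, LopU_eq hs hg, LopU_eq hs (f := f + g) (hf.add hg)]
  simp only [Pi.add_apply, mul_add]
  rw [(summable_Ker_mul hs hf x).tsum_add (summable_Ker_mul hs hg x)]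
  ring

theorem LopU_smul (c : ℝ) (f : ℤ → ℝ) : LopU s U (c • f) = c • LopU s U f := by
  ext x
  simp only [LopU, Lop, Pi.smul_apply, smul_eq_mul, mul_add, ← tsum_mul_left]
  congr 1
  · exact tsum_congr fun y => by ring
  · ring

/-- The Schrödinger operator as a bounded operator on `ℓ¹(ℤ)`. -/
noncomputable def schrodinger (hs : s ∈ Set.Ioo (0 : ℝ) 1) (hU : ∀ x, 0 ≤ U x) {M : ℝ}
    (hM : ∀ x, U x ≤ M) : EllOne →L[ℝ] EllOne :=
  LinearMap.mkContinuous
    { toFun := fun f => EllOne.mk (LopU s U f) (summable_LopU hs hU hM (EllOne.summable f))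
      map_add' := fun f g => Subtype.ext (LopU_add hs (EllOne.summable f) (EllOne.summable g))
      map_smul' := fun c f => Subtype.ext (LopU_smul c (f : ℤ → ℝ)) }
    (2 * ∑' m, Ker s m + M) fun f => by
      have hA : 0 ≤ ∑' m, Ker s m := tsum_nonneg (Ker_nonneg hs)
      have hM0 : 0 ≤ M := (hU 0).trans (hM 0)
      have h : ‖EllOne.mk (LopU s U f) (summable_LopU hs hU hM (EllOne.summable f))‖ₑ ≤
          ENNReal.ofReal (2 * ∑' m, Ker s m + M) * ‖f‖ₑ := by
        rw [EllOne.enorm_eq, EllOne.enorm_eq]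
        exact tsum_enorm_LopU_le hs hU hM (EllOne.summable f)
      rw [← ofReal_norm, ← ofReal_norm, ← ENNReal.ofReal_mul (by positivity)] at h
      exact (ENNReal.ofReal_le_ofReal_iff (by positivity)).1 h

variable (hs : s ∈ Set.Ioo (0 : ℝ) 1) (hU : ∀ x, 0 ≤ U x) {M : ℝ} (hM : ∀ x, U x ≤ M)

theorem schrodinger_pow_apply (f : EllOne) (n : ℕ) :
    ((schrodinger hs hU hM ^ n) f : ℤ → ℝ) = (LopU s U)^[n] f := by
  induction n with
  | zero => rfl
  | succ n ih =>
    rw [Function.iterate_succ_apply', ← ih, pow_succ']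
    rfl

theorem hasSum_exp_apply (T : EllOne →L[ℝ] EllOne) (t : ℝ) (f : EllOne) (x : ℤ) :
    HasSum (fun n : ℕ => t ^ n / (n.factorial : ℝ) * (T ^ n) f x)
      (NormedSpace.exp (t • T) f x) := by
  have h := NormedSpace.exp_series_hasSum_exp' (𝕂 := ℝ) (t • T)
  have h2 := ((lp.evalCLM ℝ (fun _ : ℤ => ℝ) 1 x).comp
    (ContinuousLinearMap.apply ℝ EllOne f)).hasSum h
  convert! h2 using 2 with n
  change _ = (lp.evalCLM ℝ (fun _ : ℤ => ℝ) 1 x) (((n.factorial : ℝ)⁻¹ • (t • T) ^ n) f)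
  rw [smul_pow, smul_smul]
  change _ = ((n.factorial : ℝ)⁻¹ * t ^ n) * ((T ^ n) f x)
  rw [div_eq_inv_mul]

theorem heatU_eq (f : EllOne) (t : ℝ) :
    heatU s U t f = NormedSpace.exp ((-t) • schrodinger hs hU hM) f := by
  ext x
  rw [heatU, ← (hasSum_exp_apply (schrodinger hs hU hM) (-t) f x).tsum_eq]
  exact tsum_congr fun n => by rw [schrodinger_pow_apply]

theorem norm_pow_apply_le (T : EllOne →L[ℝ] EllOne) (f : EllOne) (n : ℕ) :
    ‖(T ^ n) f‖ ≤ ‖T‖ ^ n * ‖f‖ := by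
  induction n with
  | zero => simp
  | succ n ih =>
    rw [pow_succ', pow_succ', mul_assoc]
    exact (T.le_opNorm _).trans (mul_le_mul_of_nonneg_left ih (norm_nonneg T))

theorem exists_summable_bound_exp (T : EllOne →L[ℝ] EllOne) (f : EllOne) (R : ℝ) :
    ∃ G : ℤ → ℝ, Summable G ∧ ∀ t, |t| ≤ R → ∀ x, |NormedSpace.exp (t • T) f x| ≤ G x := by
  rcases lt_or_ge R 0 with hR | hR
  · exact ⟨0, summable_zero, fun t ht => absurd (abs_nonneg t) (by linarith)⟩
  set G : ℤ → ENNReal := fun x => ∑' n : ℕ, ‖R ^ n / (n.factorial : ℝ)‖ₑ * ‖(T ^ n) f x‖ₑ with hG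
  have hfin : ∑' x, G x ≠ ⊤ := by
    rw [ENNReal.tsum_comm]
    simp_rw [ENNReal.tsum_mul_left, ← EllOne.enorm_eq]
    have hsum : Summable fun n : ℕ => R ^ n / (n.factorial : ℝ) * (‖T‖ ^ n * ‖f‖) := by
      have := (Real.summable_pow_div_factorial (R * ‖T‖)).mul_right ‖f‖
      refine this.congr fun n => ?_
      rw [mul_pow]; ring
    refine ne_top_of_le_ne_top hsum.tsum_ofReal_ne_top (ENNReal.tsum_le_tsum fun n => ?_)
    rw [ENNReal.ofReal_mul (by positivity), Real.enorm_of_nonneg (by positivity), ← ofReal_norm]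
    gcongr
    exact norm_pow_apply_le T f n
  refine ⟨fun x => (G x).toReal, ENNReal.summable_toReal hfin, fun t ht x => ?_⟩
  rw [← Real.norm_eq_abs, ← toReal_enorm]
  refine ENNReal.toReal_mono (ENNReal.ne_top_of_tsum_ne_top hfin x) ?_
  rw [← (hasSum_exp_apply T t f x).tsum_eq]
  refine enorm_tsum_le_tsum_enorm.trans (ENNReal.tsum_le_tsum fun n => ?_)
  rw [enorm_mul]
  gcongr ?_ * _
  rw [← ofReal_norm, ← ofReal_norm]
  refine ENNReal.ofReal_le_ofReal ?_
  rw [norm_div, norm_div, norm_pow, norm_pow, Real.norm_of_nonneg hR]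
  gcongr
  exact ht

theorem hasDerivAt_exp_apply (T : EllOne →L[ℝ] EllOne) (f : EllOne) (x : ℤ) (t : ℝ) :
    HasDerivAt (fun t : ℝ => NormedSpace.exp ((-t) • T) f x)
      (-(T (NormedSpace.exp ((-t) • T) f) x)) t := by
  have h := (hasDerivAt_exp_smul_const' (𝕂 := ℝ) T (-t)).scomp t (hasDerivAt_neg t)
  have h2 := ((lp.evalCLM ℝ (fun _ : ℤ => ℝ) 1 x).comp
    (ContinuousLinearMap.apply ℝ EllOne f)).hasFDerivAt.comp_hasDerivAt t h
  convert! h2 using 1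
  simp only [ContinuousLinearMap.comp_apply, ContinuousLinearMap.apply_apply, neg_smul, one_smul,
    map_neg]
  rfl

theorem exp_apply_comm (T : EllOne →L[ℝ] EllOne) (f : EllOne) (t : ℝ) :
    T (NormedSpace.exp (t • T) f) = NormedSpace.exp (t • T) (T f) := by
  have h : Commute T (NormedSpace.exp (t • T)) := ((Commute.refl T).smul_right t).exp_right
  exact DFunLike.congr_fun h.eq f

end Operator

section Domination

variable {s : ℝ} {U : ℤ → ℝ}

/-- The kernel `K_s` with an additional mass `c` at the origin. -/
noncomputable def lazyKer (s c : ℝ) (m : ℤ) : ENNReal :=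
  ENNReal.ofReal (Ker s m) + if m = 0 then ENNReal.ofReal c else 0

theorem tsum_lazyKer (hs : s ∈ Set.Ioo (0 : ℝ) 1) {c : ℝ} (hc : 0 ≤ c) :
    ∑' m, lazyKer s c m = ENNReal.ofReal (∑' m, Ker s m + c) := by
  simp only [lazyKer]
  rw [ENNReal.tsum_add, ← ENNReal.ofReal_tsum_of_nonneg (Ker_nonneg hs) (summable_Ker hs),
    tsum_ite_eq, ENNReal.ofReal_add (tsum_nonneg (Ker_nonneg hs)) hc]

theorem symmDecr_lazyKer (hs : s ∈ Set.Ioo (0 : ℝ) 1) {c : ℝ} (hc : Ker s 1 ≤ c) :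
    SymmDecr (lazyKer s c) where
  symm m := by simp [lazyKer, Ker_neg]
  succ_le n := by
    rcases n with _ | n
    · have : Ker s 0 = 0 := if_pos rfl
      simpa [lazyKer, this] using ENNReal.ofReal_le_ofReal hc
    · have h1 : (n : ℤ) + 1 + 1 ≠ 0 := by omega
      have h2 : (n : ℤ) + 1 ≠ 0 := by omega
      simpa [lazyKer, h1, h2] using ENNReal.ofReal_le_ofReal (Ker_succ_le hs n)
  tsum_ne_top := by
    rw [tsum_lazyKer hs ((Ker_nonneg hs 1).trans hc)]
    exact ENNReal.ofReal_ne_top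

variable (hs : s ∈ Set.Ioo (0 : ℝ) 1) (hU : ∀ x, 0 ≤ U x) {M : ℝ} (hM : ∀ x, U x ≤ M)

theorem enorm_shift_schrodinger_apply_le (f : EllOne) (x : ℤ) :
    ‖((∑' m, Ker s m + (Ker s 1 + M)) • (1 : EllOne →L[ℝ] EllOne) - schrodinger hs hU hM) f x‖ₑ ≤
      ∑' y, lazyKer s (Ker s 1 + M) (x - y) * ‖f y‖ₑ := by
  have hM0 : 0 ≤ M := (hU 0).trans (hM 0)
  have e : ((∑' m, Ker s m + (Ker s 1 + M)) • (1 : EllOne →L[ℝ] EllOne)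
      - schrodinger hs hU hM) f x =
      (∑' y, Ker s (x - y) * f y) + (Ker s 1 + M - U x) * f x := by
    change (∑' m, Ker s m + (Ker s 1 + M)) * f x - LopU s U f x = _
    rw [LopU_eq hs (EllOne.summable f)]
    ring
  have e2 : ∑' y, lazyKer s (Ker s 1 + M) (x - y) * ‖f y‖ₑ =
      ∑' y, ‖Ker s (x - y)‖ₑ * ‖f y‖ₑ + ENNReal.ofReal (Ker s 1 + M) * ‖f x‖ₑ := by
    rw [← tsum_ite_eq x fun y => ENNReal.ofReal (Ker s 1 + M) * ‖f y‖ₑ, ← ENNReal.tsum_add]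
    refine tsum_congr fun y => ?_
    rw [lazyKer, add_mul, Real.enorm_of_nonneg (Ker_nonneg hs _)]
    congr 1
    by_cases h : y = x
    · simp [h]
    · rw [if_neg h, if_neg (by omega), zero_mul]
  rw [e, e2]
  refine (enorm_add_le _ _).trans (add_le_add (enorm_tsum_Ker_mul_le s f x) ?_)
  have := Ker_nonneg hs 1
  rw [enorm_mul, Real.enorm_of_nonneg (by linarith [hM x])]
  gcongr
  linarith [hU x]

theorem exp_neg_smul_eq (T : EllOne →L[ℝ] EllOne) (c t : ℝ) :
    NormedSpace.exp ((-t) • T) =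
      Real.exp (-(t * c)) • NormedSpace.exp (t • (c • (1 : EllOne →L[ℝ] EllOne) - T)) := by
  let : NormedAlgebra ℚ (EllOne →L[ℝ] EllOne) := NormedAlgebra.restrictScalars ℚ ℝ _
  have e : (-t) • T = algebraMap ℝ (EllOne →L[ℝ] EllOne) (-(t * c))
      + t • (c • (1 : EllOne →L[ℝ] EllOne) - T) := by
    rw [Algebra.algebraMap_eq_smul_one, smul_sub, smul_smul, neg_smul, neg_smul]
    abel
  rw [e, NormedSpace.exp_add_of_commute (Algebra.commutes _ _),
    ← NormedSpace.algebraMap_exp_comm, Algebra.algebraMap_eq_smul_one, smul_mul_assoc, one_mul,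
    Real.exp_eq_exp_ℝ]

theorem enorm_exp_schrodinger_le (f : EllOne) {t : ℝ} (ht : 0 ≤ t) (x : ℤ) :
    ‖NormedSpace.exp ((-t) • schrodinger hs hU hM) f x‖ₑ ≤ maxFun₂ (fun y => |f y|) x := by
  have hM0 : 0 ≤ M := (hU 0).trans (hM 0)
  have hK1 := Ker_nonneg hs 1
  set c := ∑' m, Ker s m + (Ker s 1 + M) with hc
  have hc0 : 0 ≤ c := add_nonneg (tsum_nonneg (Ker_nonneg hs)) (by positivity)
  set B := c • (1 : EllOne →L[ℝ] EllOne) - schrodinger hs hU hM with hB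
  have hit : ∀ n, ‖(B ^ n) f x‖ₑ ≤ ENNReal.ofReal c ^ n * maxFun₂ (fun y => |f y|) x := fun n => by
    rw [hc, ← tsum_lazyKer hs (by positivity)]
    refine (symmDecr_lazyKer hs (by linarith)).enorm_iterate_le
      (h := fun n => ((B ^ n) f : ℤ → ℝ)) (fun n y => ?_) n x
    have : (B ^ (n + 1)) f = B ((B ^ n) f) := by rw [pow_succ']; rfl
    rw [this]
    exact enorm_shift_schrodinger_apply_le hs hU hM _ y
  have hexp : ‖NormedSpace.exp (t • B) f x‖ₑ ≤
      ENNReal.ofReal (Real.exp (t * c)) * maxFun₂ (fun y => |f y|) x := by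
    rw [← (hasSum_exp_apply B t f x).tsum_eq]
    refine enorm_tsum_le_tsum_enorm.trans ?_
    have h1 : HasSum (fun n : ℕ => (t * c) ^ n / (n.factorial : ℝ)) (Real.exp (t * c)) := by
      rw [Real.exp_eq_exp_ℝ]
      exact NormedSpace.expSeries_div_hasSum_exp (t * c)
    rw [← h1.tsum_eq, ENNReal.ofReal_tsum_of_nonneg (fun n => by positivity) h1.summable,
      ← ENNReal.tsum_mul_right]
    refine ENNReal.tsum_le_tsum fun n => ?_
    rw [enorm_mul, Real.enorm_of_nonneg (by positivity), mul_pow, mul_div_right_comm,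
      ENNReal.ofReal_mul (by positivity), ENNReal.ofReal_pow hc0, mul_assoc]
    gcongr
    exact hit n
  have e : NormedSpace.exp ((-t) • schrodinger hs hU hM) f x =
      Real.exp (-(t * c)) * NormedSpace.exp (t • B) f x := by
    rw [exp_neg_smul_eq _ c t]; rfl
  rw [e, enorm_mul, Real.enorm_of_nonneg (Real.exp_pos _).le]
  calc _ ≤ ENNReal.ofReal (Real.exp (-(t * c))) *
        (ENNReal.ofReal (Real.exp (t * c)) * maxFun₂ (fun y => |f y|) x) := by gcongr
    _ = _ := by
      rw [← mul_assoc, ← ENNReal.ofReal_mul (Real.exp_pos _).le, ← Real.exp_add]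
      simp

end Domination

section Bregman

variable {q : ℝ}

/-- The Bregman divergence of `x ↦ |x| ^ q`. -/
noncomputable def bregman (q a b : ℝ) : ℝ := |b| ^ q - |a| ^ q - q * |a| ^ (q - 2) * a * (b - a)

theorem abs_rpow_sub_two_mul_sq {a : ℝ} (ha : a ≠ 0) (q : ℝ) : |a| ^ (q - 2) * a ^ 2 = |a| ^ q := by
  have h := abs_pos.2 ha
  rw [← sq_abs, ← Real.rpow_natCast |a| 2, ← Real.rpow_add h]
  norm_num

theorem bregman_mul {a : ℝ} (ha : a ≠ 0) (q r : ℝ) :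
    bregman q a (a * r) = |a| ^ q * (|r| ^ q - 1 - q * (r - 1)) := by
  rw [bregman, abs_mul, Real.mul_rpow (abs_nonneg _) (abs_nonneg _)]
  linear_combination (-(q * (r - 1))) * abs_rpow_sub_two_mul_sq ha q

theorem bregman_nonneg (hq : 1 < q) (a b : ℝ) : 0 ≤ bregman q a b := by
  rcases eq_or_ne a 0 with rfl | ha
  · have : (0 : ℝ) ^ q = 0 := Real.zero_rpow (by linarith)
    simp only [bregman, abs_zero, this]
    have := Real.rpow_nonneg (abs_nonneg b) q
    simpa using this
  · obtain ⟨r, rfl⟩ : ∃ r, b = a * r := ⟨b / a, by field_simp⟩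
    rw [bregman_mul ha]
    refine mul_nonneg (Real.rpow_nonneg (abs_nonneg _) _) ?_
    rcases le_or_gt 0 r with hr | hr
    · have := one_add_mul_self_le_rpow_one_add (s := r - 1) (by linarith) hq.le
      rw [abs_of_nonneg hr]
      rw [add_sub_cancel] at this
      linarith
    · nlinarith [Real.rpow_nonneg (abs_nonneg r) q]

theorem abs_rpow_sub_two_mul_le (hq : q ∈ Set.Ioc (1 : ℝ) 2) {r : ℝ} (hr : |r| ≤ 1) :
    |r| ^ (q - 2) * r ≤ 1 + (q - 1) * (r - 1) := by
  obtain ⟨h1, h2⟩ := hq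
  rcases lt_trichotomy r 0 with h | h | h
  · have h0 : 0 < |r| := abs_pos.2 h.ne
    have : |r| ^ (1 : ℝ) ≤ |r| ^ (q - 1) :=
      Real.rpow_le_rpow_of_exponent_ge h0 hr (by linarith)
    have e : |r| ^ (q - 1) = |r| ^ (q - 2) * |r| := by
      rw [← Real.rpow_add_one h0.ne']; congr 1; ring
    rw [Real.rpow_one, e] at this
    rw [abs_of_neg h] at *
    nlinarith
  · subst h; simp; linarith
  · have e : |r| ^ (q - 1) = |r| ^ (q - 2) * r := by
      conv_rhs => rw [← abs_of_pos h, abs_abs, ← Real.rpow_add_one (abs_pos.2 h.ne').ne']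
      congr 1; ring
    rw [← e, abs_of_pos h]
    have := rpow_one_add_le_one_add_mul_self (s := r - 1) (p := q - 1) (by linarith)
      (by linarith) (by linarith)
    rwa [add_sub_cancel] at this

theorem mul_sq_le_abs_rpow_sub (hq : q ∈ Set.Ioc (1 : ℝ) 2) {r : ℝ} (hr : |r| ≤ 1) :
    q * (q - 1) / 2 * (r - 1) ^ 2 ≤ |r| ^ q - 1 - q * (r - 1) := by
  have hd : ∀ x, HasDerivAt (fun x : ℝ => |x| ^ q - 1 - q * (x - 1) - q * (q - 1) / 2 * (x - 1) ^ 2)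
      (q * |x| ^ (q - 2) * x - q * 1 - q * (q - 1) / 2 * (2 * (x - 1) * 1)) x := fun x => by
    have h1 := hasDerivAt_abs_rpow x hq.1
    have h2 := (hasDerivAt_id x).sub_const 1
    have h3 := h2.pow 2
    convert! ((h1.sub_const 1).sub (h2.const_mul q)).sub (h3.const_mul (q * (q - 1) / 2)) using 1
    simp
  have hanti := antitoneOn_of_deriv_nonpos (convex_Icc (-1 : ℝ) 1)
    (fun x _ => (hd x).continuousAt.continuousWithinAt)
    (fun x _ => (hd x).differentiableAt.differentiableWithinAt) fun x hx => by
      rw [interior_Icc] at hx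
      rw [(hd x).deriv]
      have := abs_rpow_sub_two_mul_le hq (abs_le.2 ⟨hx.1.le, hx.2.le⟩)
      nlinarith [hq.1]
  have := hanti (abs_le.1 hr) (by simp : (1 : ℝ) ∈ Set.Icc (-1 : ℝ) 1) (abs_le.1 hr).2
  simp at this
  linarith

theorem sq_sub_le_mul_bregman (hq : q ∈ Set.Ioc (1 : ℝ) 2) {a b : ℝ} (h : |b| < |a|) :
    (a - b) ^ 2 ≤ 2 / (q * (q - 1)) * |a| ^ (2 - q) * bregman q a b := by
  have h0 : 0 < |a| := (abs_nonneg b).trans_lt h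
  have ha : a ≠ 0 := abs_pos.1 h0
  obtain ⟨r, rfl⟩ : ∃ r, b = a * r := ⟨b / a, by field_simp⟩
  have hr : |r| ≤ 1 := by
    rw [abs_mul] at h
    exact ((mul_lt_iff_lt_one_right h0).1 h).le
  have hc : 0 < q * (q - 1) := mul_pos (by linarith [hq.1]) (by linarith [hq.1])
  have key := mul_sq_le_abs_rpow_sub hq hr
  have e : |a| ^ (2 - q) * |a| ^ q = a ^ 2 := by
    rw [← Real.rpow_add h0, ← sq_abs a, ← Real.rpow_natCast |a| 2]
    norm_num
  rw [bregman_mul ha]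
  calc (a - a * r) ^ 2 = a ^ 2 * (2 / (q * (q - 1)) * (q * (q - 1) / 2 * (r - 1) ^ 2)) := by
        have : q ≠ 0 := by rintro rfl; simp at hc
        have : q - 1 ≠ 0 := by intro h; simp [h] at hc
        field_simp
        ring
    _ ≤ a ^ 2 * (2 / (q * (q - 1)) * (|r| ^ q - 1 - q * (r - 1))) := by gcongr
    _ = _ := by rw [← e]; ring

end Bregman

section Dissipation

variable {s q : ℝ} {U : ℤ → ℝ}

theorem hasSum_tsum_Ker_mul (hs : s ∈ Set.Ioo (0 : ℝ) 1) {w : ℤ → ℝ} (hw : ∀ x, 0 ≤ w x)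
    (hws : Summable w) :
    HasSum (fun x => ∑' y, Ker s (x - y) * w y) ((∑' m, Ker s m) * ∑' y, w y) := by
  let e : ℤ × ℤ ≃ ℤ × ℤ :=
    ⟨fun p => (p.1 - p.2, p.2), fun p => (p.1 + p.2, p.2), fun p => by simp, fun p => by simp⟩
  have h := e.hasSum_iff.2 ((summable_Ker hs).hasSum.mul hws.hasSum
    ((summable_Ker hs).mul_of_nonneg hws (Ker_nonneg hs) hw))
  exact h.prod_fiberwise fun x => (summable_Ker_mul hs hws x).hasSum

theorem abs_mul_rpow_sub_two (hq : 1 < q) (a : ℝ) : |(|a| ^ (q - 2) * a)| = |a| ^ (q - 1) := by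
  rw [abs_mul, abs_of_nonneg (Real.rpow_nonneg (abs_nonneg a) _)]
  rcases eq_or_ne a 0 with rfl | h
  · rw [abs_zero, mul_zero, Real.zero_rpow (by linarith)]
  · rw [← Real.rpow_add_one (abs_pos.2 h).ne']
    congr 1; ring

/-- The energy production density of the flow of `L_U` for the functional `∑ |v| ^ q`. -/
noncomputable def energyRate (s : ℝ) (U : ℤ → ℝ) (q : ℝ) (v : ℤ → ℝ) (x : ℤ) : ℝ :=
  q * |v x| ^ (q - 2) * v x * LopU s U v x

/-- The nonnegative dissipation density of the flow of `L_U` for the functional `∑ |v| ^ q`. -/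
noncomputable def dissipation (s : ℝ) (U : ℤ → ℝ) (q : ℝ) (v : ℤ → ℝ) (x : ℤ) : ℝ :=
  ∑' y, Ker s (x - y) * bregman q (v x) (v y) + q * (U x * |v x| ^ q)

theorem abs_energyRate_le (hq : 1 < q) {v : ℤ → ℝ} {x : ℤ} {a b : ℝ} (ha : |v x| ≤ a)
    (hb : |LopU s U v x| ≤ b) : |energyRate s U q v x| ≤ q * a ^ (q - 1) * b := by
  rw [energyRate, mul_assoc q, abs_mul, abs_mul, abs_mul_rpow_sub_two hq, abs_of_pos (by linarith)]
  have := (abs_nonneg _).trans ha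
  gcongr

variable (hs : s ∈ Set.Ioo (0 : ℝ) 1) (hU : ∀ x, 0 ≤ U x) {M : ℝ} (hM : ∀ x, U x ≤ M)
  {v : ℤ → ℝ} (hv : Summable v)

include hv in
theorem summable_abs_rpow (hq : 1 ≤ q) : Summable fun x => |v x| ^ q :=
  Summable.rpow_of_one_le (fun _ => abs_nonneg _) hv.abs hq

include hs hv in
theorem hasSum_Ker_mul_bregman (hq : 1 < q) (x : ℤ) :
    HasSum (fun y => Ker s (x - y) * bregman q (v x) (v y))
      ((∑' y, Ker s (x - y) * |v y| ^ q - (∑' m, Ker s m) * |v x| ^ q)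
        - q * |v x| ^ (q - 2) * v x * (∑' y, Ker s (x - y) * v y - (∑' m, Ker s m) * v x)) := by
  have h1 := (summable_Ker_mul hs (summable_abs_rpow hv hq.le) x).hasSum
  have h2 := (summable_Ker_mul hs hv x).hasSum
  have h3 := (summable_Ker_sub hs x).hasSum
  rw [tsum_Ker_sub] at h3
  convert! (h1.sub (h3.mul_right (|v x| ^ q))).sub
    ((h2.sub (h3.mul_right (v x))).mul_left (q * |v x| ^ (q - 2) * v x)) using 2 with y
  rw [bregman]; ring

theorem abs_rpow_sub_two_mul_sq_of_pos (hq : 0 < q) (a : ℝ) :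
    |a| ^ (q - 2) * a ^ 2 = |a| ^ q := by
  rcases eq_or_ne a 0 with rfl | h
  · simp [Real.zero_rpow hq.ne']
  · exact abs_rpow_sub_two_mul_sq h q

include hs hv in
theorem dissipation_eq (hq : 1 < q) (x : ℤ) :
    dissipation s U q v x = energyRate s U q v x +
      (∑' y, Ker s (x - y) * |v y| ^ q - (∑' m, Ker s m) * |v x| ^ q) := by
  rw [dissipation, (hasSum_Ker_mul_bregman hs hv hq x).tsum_eq, energyRate, LopU_eq hs hv]
  linear_combination (-(q * U x)) * abs_rpow_sub_two_mul_sq_of_pos (zero_lt_one.trans hq) (v x)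

include hs hU in
theorem dissipation_nonneg (hq : 1 < q) (v : ℤ → ℝ) (x : ℤ) : 0 ≤ dissipation s U q v x := by
  have := Real.rpow_nonneg (abs_nonneg (v x)) q
  have := hU x
  exact add_nonneg (tsum_nonneg fun y => mul_nonneg (Ker_nonneg hs _) (bregman_nonneg hq _ _))
    (by positivity)

include hs hU hM hv in
theorem summable_energyRate (hq : 1 < q) : Summable (energyRate s U q v) := by
  have h := (summable_LopU hs hU hM hv).abs
  refine Summable.of_norm_bounded (h.mul_left (q * (∑' x, |v x|) ^ (q - 1))) fun x => ?_
  exact abs_energyRate_le hq (hv.abs.le_tsum x fun _ _ => abs_nonneg _) le_rfl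

include hs hU hM hv in
theorem hasSum_dissipation (hq : 1 < q) :
    HasSum (dissipation s U q v) (∑' x, energyRate s U q v x) := by
  have hw := summable_abs_rpow hv hq.le
  have h := (summable_energyRate hs hU hM hv hq).hasSum.add
    ((hasSum_tsum_Ker_mul hs (fun _ => by positivity) hw).sub
      (hw.hasSum.mul_left (∑' m, Ker s m)))
  rw [sub_self, add_zero] at h
  exact h.congr_fun fun x => dissipation_eq hs hv hq x

end Dissipation

section Energy

variable {s q : ℝ} {U : ℤ → ℝ}
variable (hs : s ∈ Set.Ioo (0 : ℝ) 1) (hU : ∀ x, 0 ≤ U x) {M : ℝ} (hM : ∀ x, U x ≤ M) (f : EllOne)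

theorem hasDerivAt_tsum_abs_rpow (hq : 1 < q) (t : ℝ) :
    HasDerivAt (fun t : ℝ => ∑' x, |NormedSpace.exp ((-t) • schrodinger hs hU hM) f x| ^ q)
      (∑' x, -energyRate s U q (NormedSpace.exp ((-t) • schrodinger hs hU hM) f) x) t := by
  set T := schrodinger hs hU hM with hT
  obtain ⟨G, hGs, hG⟩ := exists_summable_bound_exp T f (|t| + 1)
  obtain ⟨H, hHs, hH⟩ := exists_summable_bound_exp T (T f) (|t| + 1)
  have habs : ∀ r ∈ Metric.ball t 1, |-r| ≤ |t| + 1 := fun r hr => by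
    rw [Metric.mem_ball, Real.dist_eq] at hr
    rw [abs_neg]
    have := abs_sub_abs_le_abs_sub r t
    linarith
  have ht : t ∈ Metric.ball t 1 := Metric.mem_ball_self one_pos
  have hG0 : ∀ x, 0 ≤ G x := fun x => (abs_nonneg _).trans (hG _ (habs t ht) x)
  have hsum := summable_abs_rpow (EllOne.summable (NormedSpace.exp ((-t) • T) f)) hq.le
  refine hasDerivAt_tsum_of_isPreconnected (t := Metric.ball t 1) (y₀ := t)
    (g := fun x t => |NormedSpace.exp ((-t) • T) f x| ^ q)
    (g' := fun x t => -energyRate s U q (NormedSpace.exp ((-t) • T) f) x)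
    (hHs.mul_left (q * (∑' x, G x) ^ (q - 1)))
    Metric.isOpen_ball (convex_ball t 1).isPreconnected (fun x r _ => ?_) (fun x r hr => ?_) ht
    hsum ht
  · have h := (hasDerivAt_abs_rpow (NormedSpace.exp ((-r) • T) f x) hq).comp r
      (hasDerivAt_exp_apply T f x r)
    convert! h using 1
    rw [mul_neg]; rfl
  · rw [norm_neg]
    refine abs_energyRate_le hq
      ((hG _ (habs r hr) x).trans (hGs.le_tsum x fun y _ => hG0 y)) ?_
    have e : LopU s U (NormedSpace.exp ((-r) • T) f) x = NormedSpace.exp ((-r) • T) (T f) x := by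
      rw [← exp_apply_comm]; rfl
    rw [e]
    exact hH _ (habs r hr) x

theorem tsum_lintegral_le (μ : Measure ℝ) (g : ℤ → ℝ → ENNReal) :
    ∑' x, ∫⁻ t, g x t ∂μ ≤ ∫⁻ t, ∑' x, g x t ∂μ := by
  classical
  rw [ENNReal.tsum_eq_iSup_sum]
  refine iSup_le fun S => ?_
  have h : ∑ x ∈ S, ∫⁻ t, g x t ∂μ ≤ ∫⁻ t, ∑ x ∈ S, g x t ∂μ := by
    induction S using Finset.induction_on with
    | empty => simp
    | insert a S ha ih =>
      simp only [Finset.sum_insert ha]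
      exact (add_le_add le_rfl ih).trans (le_lintegral_add _ _)
  exact h.trans (lintegral_mono fun t => ENNReal.sum_le_tsum S)

theorem tsum_lintegral_dissipation_le (hq : 1 < q) :
    ∑' x, ∫⁻ t in Set.Ioi (0 : ℝ), ENNReal.ofReal
      (dissipation s U q (NormedSpace.exp ((-t) • schrodinger hs hU hM) f) x) ≤
      ∑' x, ENNReal.ofReal (|f x| ^ q) := by
  set T := schrodinger hs hU hM with hT
  set E : ℝ → ℝ := fun t => ∑' x, energyRate s U q (NormedSpace.exp ((-t) • T) f) x with hE
  set N : ℝ → ℝ := fun t => ∑' x, |NormedSpace.exp ((-t) • T) f x| ^ q with hN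
  have hdis : ∀ t, HasSum (dissipation s U q (NormedSpace.exp ((-t) • T) f)) (E t) := fun t =>
    hasSum_dissipation hs hU hM (EllOne.summable _) hq
  have hE0 : ∀ t, 0 ≤ E t := fun t => (hdis t).nonneg fun x => dissipation_nonneg hs hU hq _ x
  have hd : ∀ t, HasDerivAt N (-E t) t := fun t => by
    have h := hasDerivAt_tsum_abs_rpow hs hU hM f hq t
    rwa [tsum_neg] at h
  have hN0 : ∀ t, 0 ≤ N t := fun t => tsum_nonneg fun x => by positivity
  have hanti : Antitone N := antitone_of_deriv_nonpos (fun t => (hd t).differentiableAt)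
    fun t => by rw [(hd t).deriv]; linarith [hE0 t]
  have hlim := tendsto_atTop_ciInf hanti ⟨0, by rintro _ ⟨t, rfl⟩; exact hN0 t⟩
  have hneg : ∀ t ∈ Set.Ioi (0 : ℝ), -E t ≤ 0 := fun t _ => by linarith [hE0 t]
  have hdint := integral_Ioi_of_hasDerivAt_of_nonpos' (a := 0) (fun t _ => hd t) hneg hlim
  have hEint : IntegrableOn E (Set.Ioi 0) := by
    simpa using (integrableOn_Ioi_deriv_of_nonpos' (a := 0) (fun t _ => hd t) hneg hlim).neg
  have hN1 : N 0 = ∑' x, |f x| ^ q := by simp [hN]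
  calc _ ≤ ∫⁻ t in Set.Ioi (0 : ℝ), ∑' x, ENNReal.ofReal
        (dissipation s U q (NormedSpace.exp ((-t) • T) f) x) := tsum_lintegral_le _ _
    _ = ∫⁻ t in Set.Ioi (0 : ℝ), ENNReal.ofReal (E t) := by
      refine lintegral_congr fun t => ?_
      rw [← (hdis t).tsum_eq, ENNReal.ofReal_tsum_of_nonneg (dissipation_nonneg hs hU hq _)
        (hdis t).summable]
    _ = ENNReal.ofReal (∫ t in Set.Ioi (0 : ℝ), E t) :=
      (ofReal_integral_eq_lintegral_ofReal hEint (Filter.Eventually.of_forall hE0)).symm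
    _ ≤ ENNReal.ofReal (N 0) := by
      refine ENNReal.ofReal_le_ofReal ?_
      rw [integral_neg] at hdint
      have : 0 ≤ ⨅ t, N t := le_ciInf hN0
      linarith
    _ = _ := by
      rw [hN1, ENNReal.ofReal_tsum_of_nonneg (fun x => by positivity)
        (summable_abs_rpow (EllOne.summable f) hq.le)]

end Energy

section LittlewoodPaley

variable {s q : ℝ} {U : ℤ → ℝ}
variable (hs : s ∈ Set.Ioo (0 : ℝ) 1) (hU : ∀ x, 0 ≤ U x) {M : ℝ} (hM : ∀ x, U x ≤ M)

include hs in
theorem mgradSq_nonneg (v : ℤ → ℝ) (x : ℤ) : 0 ≤ mgradSq s v x :=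
  tsum_nonneg fun _ => mul_nonneg (Ker_nonneg hs _) (sq_nonneg _)

include hs in
theorem mgradSq_le (hq : q ∈ Set.Ioc (1 : ℝ) 2) {v : ℤ → ℝ} (hv : Summable v) (x : ℤ) :
    mgradSq s v x ≤ 2 / (q * (q - 1)) * |v x| ^ (2 - q) *
      ∑' y, Ker s (x - y) * bregman q (v x) (v y) := by
  have hc : 0 < q * (q - 1) := mul_pos (by linarith [hq.1]) (by linarith [hq.1])
  have hsum := (hasSum_Ker_mul_bregman hs hv hq.1 x).summable.mul_left
    (2 / (q * (q - 1)) * |v x| ^ (2 - q))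
  have key : ∀ y, {y | |v y| < |v x|}.indicator (fun y => Ker s (y - x) * (v x - v y) ^ 2) y ≤
      2 / (q * (q - 1)) * |v x| ^ (2 - q) * (Ker s (x - y) * bregman q (v x) (v y)) := fun y => by
    have hK := Ker_nonneg hs (x - y)
    by_cases h : |v y| < |v x|
    · rw [Set.indicator_of_mem (s := {y | |v y| < |v x|}) h, ← Ker_neg s (y - x), neg_sub,
        mul_left_comm]
      exact mul_le_mul_of_nonneg_left (sq_sub_le_mul_bregman hq h) hK
    · rw [Set.indicator_of_notMem (s := {y | |v y| < |v x|}) h]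
      have := bregman_nonneg hq.1 (v x) (v y)
      positivity
  have h0 : ∀ y, 0 ≤ {y | |v y| < |v x|}.indicator (fun y => Ker s (y - x) * (v x - v y) ^ 2) y :=
    fun y => Set.indicator_nonneg (fun _ _ => mul_nonneg (Ker_nonneg hs _) (sq_nonneg _)) y
  rw [← tsum_mul_left]
  refine (tsum_subtype {y | |v y| < |v x|} fun y => Ker s (y - x) * (v x - v y) ^ 2).trans_le ?_
  exact (hsum.of_nonneg_of_le h0 key).tsum_le_tsum key hsum

include hs hU in
theorem mgradSq_add_le (hq : q ∈ Set.Ioc (1 : ℝ) 2) {v : ℤ → ℝ} (hv : Summable v) (x : ℤ) :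
    mgradSq s v x + U x * v x ^ 2 ≤
      2 / (q * (q - 1)) * |v x| ^ (2 - q) * dissipation s U q v x := by
  obtain ⟨h1, h2⟩ := hq
  rw [dissipation, mul_add]
  refine add_le_add (mgradSq_le hs ⟨h1, h2⟩ hv x) ?_
  have e : v x ^ 2 ≤ |v x| ^ (2 - q) * |v x| ^ q := by
    rcases eq_or_ne (v x) 0 with h | h
    · rw [h, sq, zero_mul]; positivity
    · rw [← Real.rpow_add (abs_pos.2 h), ← sq_abs (v x), ← Real.rpow_natCast |v x| 2]
      norm_num
  have hc : 1 ≤ 2 / (q - 1) := by rw [one_le_div (by linarith)]; linarith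
  have hq1 : q - 1 ≠ 0 := by linarith
  have hq0 : q ≠ 0 := by linarith
  calc U x * v x ^ 2 ≤ 1 * (U x * (|v x| ^ (2 - q) * |v x| ^ q)) := by
        rw [one_mul]; exact mul_le_mul_of_nonneg_left e (hU x)
    _ ≤ 2 / (q - 1) * (U x * (|v x| ^ (2 - q) * |v x| ^ q)) := by
        have := hU x
        gcongr
    _ = _ := by field_simp

/-- The constant in the `ℓ^q` bound for the square function. -/
noncomputable def squareFunConst (q : ℝ) : ENNReal :=
  ENNReal.ofReal (2 / (q * (q - 1))) ^ (q / 2) *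
    (2 ^ (q - 1) * (2 * ENNReal.ofReal (q / (q - 1)) ^ q)) ^ ((2 - q) / 2)

theorem squareFunConst_ne_top (hq : q ∈ Set.Ioc (1 : ℝ) 2) : squareFunConst q ≠ ⊤ := by
  obtain ⟨h1, h2⟩ := hq
  have h2' : (2 : ENNReal) ≠ ⊤ := ENNReal.ofNat_ne_top
  refine ENNReal.mul_ne_top (ENNReal.rpow_ne_top_of_nonneg (by linarith) ENNReal.ofReal_ne_top)
    (ENNReal.rpow_ne_top_of_nonneg (by linarith) (ENNReal.mul_ne_top
      (ENNReal.rpow_ne_top_of_nonneg (by linarith) h2')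
      (ENNReal.mul_ne_top h2' (ENNReal.rpow_ne_top_of_nonneg (by linarith) ENNReal.ofReal_ne_top))))

theorem tsum_rpow_mul_rpow_le (hq : q ∈ Set.Ioc (1 : ℝ) 2) (a b : ℤ → ENNReal) :
    ∑' x, a x ^ ((2 - q) / 2) * b x ^ (q / 2) ≤
      (∑' x, a x) ^ ((2 - q) / 2) * (∑' x, b x) ^ (q / 2) := by
  have := ENNReal.lintegral_mul_norm_pow_le (μ := Measure.count) (f := a) (g := b)
    (measurable_of_countable a).aemeasurable (measurable_of_countable b).aemeasurable
    (p := (2 - q) / 2) (q := q / 2) (by linarith [hq.2]) (by linarith [hq.1]) (by ring)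
  simpa only [lintegral_count] using this

include hs hU hM in
theorem ofReal_integral_le (hq : q ∈ Set.Ioc (1 : ℝ) 2) (f : EllOne) {x : ℤ}
    (hx : maxFun₂ (fun y => |f y|) x ≠ ⊤) :
    ENNReal.ofReal (∫ t in Set.Ioi (0 : ℝ),
      (mgradSq s (heatU s U t f) x + U x * (heatU s U t f x) ^ 2)) ≤
      ENNReal.ofReal (2 / (q * (q - 1))) * maxFun₂ (fun y => |f y|) x ^ (2 - q) *
        ∫⁻ t in Set.Ioi (0 : ℝ), ENNReal.ofReal
          (dissipation s U q (NormedSpace.exp ((-t) • schrodinger hs hU hM) f) x) := by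
  have hq2 : 0 ≤ 2 - q := by linarith [hq.2]
  have hC : 0 ≤ 2 / (q * (q - 1)) :=
    (div_pos two_pos (mul_pos (by linarith [hq.1]) (by linarith [hq.1]))).le
  simp_rw [heatU_eq hs hU hM f]
  have hnn : ∀ v : ℤ → ℝ, 0 ≤ mgradSq s v x + U x * v x ^ 2 := fun v =>
    add_nonneg (mgradSq_nonneg hs v x) (mul_nonneg (hU x) (sq_nonneg _))
  rw [← Real.enorm_of_nonneg (integral_nonneg fun t => hnn _), ← lintegral_const_mul' _ _
    (ENNReal.mul_ne_top ENNReal.ofReal_ne_top (ENNReal.rpow_ne_top_of_nonneg hq2 hx))]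
  refine (enorm_integral_le_lintegral_enorm _).trans (setLIntegral_mono' measurableSet_Ioi ?_)
  intro t ht
  rw [Real.enorm_of_nonneg (hnn _)]
  refine (ENNReal.ofReal_le_ofReal (mgradSq_add_le hs hU hq (EllOne.summable _) x)).trans ?_
  rw [ENNReal.ofReal_mul (by positivity), ENNReal.ofReal_mul hC,
    ← ENNReal.ofReal_rpow_of_nonneg (abs_nonneg _) hq2, ← Real.enorm_eq_ofReal_abs]
  gcongr
  exact enorm_exp_schrodinger_le hs hU hM f (le_of_lt ht) x

include hs hU hM in
theorem tsum_ofReal_squareFun_rpow_le (hq : q ∈ Set.Ioc (1 : ℝ) 2) (f : EllOne) :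
    ∑' x, ENNReal.ofReal (|√(∫ t in Set.Ioi (0 : ℝ),
      (mgradSq s (heatU s U t f) x + U x * (heatU s U t f x) ^ 2))| ^ q) ≤
      squareFunConst q * ∑' x, ENNReal.ofReal (|f x| ^ q) := by
  have h1 := hq.1
  have h2 := hq.2
  set S := ∑' x, ENNReal.ofReal (|f x| ^ q) with hS
  set W := maxFun₂ fun y => |f y| with hW
  set I : ℤ → ENNReal := fun x => ∫⁻ t in Set.Ioi (0 : ℝ), ENNReal.ofReal
    (dissipation s U q (NormedSpace.exp ((-t) • schrodinger hs hU hM) f) x) with hI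
  have hSfin : S ≠ ⊤ := (summable_abs_rpow (EllOne.summable f) h1.le).tsum_ofReal_ne_top
  have hWle : ∑' x, W x ^ q ≤ 2 ^ (q - 1) * (2 * ENNReal.ofReal (q / (q - 1)) ^ q) * S :=
    tsum_maxFun₂_rpow_le (fun _ => abs_nonneg _) (EllOne.summable f).abs h1
  have hWfin : ∀ x, W x ≠ ⊤ := fun x hx => by
    have h2' : (2 : ENNReal) ≠ ⊤ := ENNReal.ofNat_ne_top
    have : ∑' x, W x ^ q ≠ ⊤ := ne_top_of_le_ne_top (ENNReal.mul_ne_top (ENNReal.mul_ne_top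
      (ENNReal.rpow_ne_top_of_nonneg (by linarith) h2') (ENNReal.mul_ne_top h2'
        (ENNReal.rpow_ne_top_of_nonneg (by linarith) ENNReal.ofReal_ne_top))) hSfin) hWle
    refine ENNReal.ne_top_of_tsum_ne_top this x ?_
    rw [hx, ENNReal.top_rpow_of_pos (by linarith)]
  have hterm : ∀ x, ENNReal.ofReal (|√(∫ t in Set.Ioi (0 : ℝ),
      (mgradSq s (heatU s U t f) x + U x * (heatU s U t f x) ^ 2))| ^ q) ≤
      ENNReal.ofReal (2 / (q * (q - 1))) ^ (q / 2) *
        ((W x ^ q) ^ ((2 - q) / 2) * I x ^ (q / 2)) := fun x => by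
    have hnn : 0 ≤ ∫ t in Set.Ioi (0 : ℝ),
        (mgradSq s (heatU s U t f) x + U x * (heatU s U t f x) ^ 2) :=
      integral_nonneg fun t => add_nonneg (mgradSq_nonneg hs _ x) (mul_nonneg (hU x) (sq_nonneg _))
    rw [abs_of_nonneg (Real.sqrt_nonneg _), Real.sqrt_eq_rpow, ← Real.rpow_mul hnn,
      ← ENNReal.ofReal_rpow_of_nonneg hnn (by linarith), one_div_mul_eq_div]
    refine (ENNReal.rpow_le_rpow (ofReal_integral_le hs hU hM hq f (hWfin x))
      (by linarith)).trans_eq ?_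
    rw [ENNReal.mul_rpow_of_nonneg _ _ (by linarith), ENNReal.mul_rpow_of_nonneg _ _ (by linarith),
      ← ENNReal.rpow_mul, ← ENNReal.rpow_mul, mul_assoc]
    congr 3
    ring
  calc _ ≤ ∑' x, ENNReal.ofReal (2 / (q * (q - 1))) ^ (q / 2) *
        ((W x ^ q) ^ ((2 - q) / 2) * I x ^ (q / 2)) := ENNReal.tsum_le_tsum hterm
    _ ≤ ENNReal.ofReal (2 / (q * (q - 1))) ^ (q / 2) *
        ((∑' x, W x ^ q) ^ ((2 - q) / 2) * (∑' x, I x) ^ (q / 2)) := by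
      rw [ENNReal.tsum_mul_left]
      gcongr
      exact tsum_rpow_mul_rpow_le hq _ _
    _ ≤ ENNReal.ofReal (2 / (q * (q - 1))) ^ (q / 2) *
        ((2 ^ (q - 1) * (2 * ENNReal.ofReal (q / (q - 1)) ^ q) * S) ^ ((2 - q) / 2)
          * S ^ (q / 2)) := by
      refine mul_le_mul_right (mul_le_mul' (ENNReal.rpow_le_rpow hWle (by linarith))
        (ENNReal.rpow_le_rpow (tsum_lintegral_dissipation_le hs hU hM f h1) (by linarith))) _
    _ = _ := by
      rw [ENNReal.mul_rpow_of_nonneg _ S (by linarith), mul_assoc, ← ENNReal.rpow_add_of_nonneg _ _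
        (by linarith) (by linarith), squareFunConst, ← mul_assoc]
      have : (2 - q) / 2 + q / 2 = 1 := by ring
      rw [this, ENNReal.rpow_one]

theorem tsum_eq_toReal_tsum_ofReal {a : ℤ → ℝ} (ha : ∀ x, 0 ≤ a x) :
    ∑' x, a x = (∑' x, ENNReal.ofReal (a x)).toReal := by
  rw [ENNReal.tsum_toReal_eq fun _ => ENNReal.ofReal_ne_top]
  exact tsum_congr fun x => (ENNReal.toReal_ofReal (ha x)).symm

end LittlewoodPaley

/-- For every `q ∈ (1,2]` there is `c_q > 0`, depending only on `q` and `s`, such that for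
every bounded nonnegative potential `U` and every summable `f`, `‖G̃_U f‖_q ≤ c_q ‖f‖_q`,
where `G̃_U f x = (∫₀^∞ (|∇̃ (P_t^U f)|²(x) + U x · (P_t^U f x)²) dt)^{1/2}`. -/
theorem lq_bound_Gtilde_schrodinger (s : ℝ) (hs : s ∈ Set.Ioo (0 : ℝ) 1) (q : ℝ)
    (hq : q ∈ Set.Ioc (1 : ℝ) 2) :
    ∃ c : ℝ, 0 < c ∧ ∀ U : ℤ → ℝ, (∀ x, 0 ≤ U x) → (∃ M : ℝ, ∀ x, U x ≤ M) →
      ∀ f : ℤ → ℝ, Summable f →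
        lqNorm q (fun x => Real.sqrt (∫ t in Set.Ioi (0 : ℝ),
          (mgradSq s (heatU s U t f) x + U x * (heatU s U t f x) ^ 2))) ≤
          c * lqNorm q f := by
  have hq0 : 0 ≤ 1 / q := by have := hq.1; positivity
  refine ⟨(squareFunConst q).toReal ^ (1 / q) + 1, by positivity, ?_⟩
  rintro U hU ⟨M, hM⟩ f hf
  have h := tsum_ofReal_squareFun_rpow_le hs hU hM hq (EllOne.mk f hf)
  have hfin : ∑' x, ENNReal.ofReal (|f x| ^ q) ≠ ⊤ :=
    (summable_abs_rpow hf hq.1.le).tsum_ofReal_ne_top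
  have h' := ENNReal.toReal_mono (ENNReal.mul_ne_top (squareFunConst_ne_top hq) hfin) h
  rw [ENNReal.toReal_mul, ← tsum_eq_toReal_tsum_ofReal fun _ => by positivity,
    ← tsum_eq_toReal_tsum_ofReal fun _ => by positivity] at h'
  have hf0 : 0 ≤ ∑' x, |f x| ^ q := tsum_nonneg fun _ => by positivity
  calc _ ≤ ((squareFunConst q).toReal * ∑' x, |f x| ^ q) ^ (1 / q) :=
        Real.rpow_le_rpow (tsum_nonneg fun _ => by positivity) h' hq0
    _ = (squareFunConst q).toReal ^ (1 / q) * lqNorm q f :=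
        Real.mul_rpow ENNReal.toReal_nonneg hf0
    _ ≤ _ := by
        have : 0 ≤ lqNorm q f := Real.rpow_nonneg hf0 _
        gcongr
        linarith
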